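/- arXiv:2102.08995 — 2 statements merged into one kernel-verified Lean document; each statement's English description precedes it below -/
import Mathlib

section
/- For all integers r ≥ 3 and any real number ξ with 0 < ξ ≤ 3/(5 + 8·log₂ r), there exists n₀ ∈ ℕ such that for all n ≥ n₀ the following holds: if A ⊆ [n] and |A| ≥ (1 − ξ)n, then g_r(A) ≤ C(r,2)·2^{|A|} + 2^{−n/(36·log₂ n)}·2^n, where C(r,2) = r(r−1)/2. -/
/-- A coloring `c : A → Fin r` is rainbow 3-AP-free if no 3-AP of `A`
(i.e. a triple `(a, a+d, a+2d)` with `d ≥ 1` and all three elements in `A`)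
receives three pairwise distinct colors. -/
def RainbowAPFree {r : ℕ} (A : Finset ℕ) (c : A → Fin r) : Prop :=
  ∀ a d : ℕ, 0 < d → ∀ (h1 : a ∈ A) (h2 : a + d ∈ A) (h3 : a + 2 * d ∈ A),
    c ⟨a, h1⟩ = c ⟨a + d, h2⟩ ∨ c ⟨a + d, h2⟩ = c ⟨a + 2 * d, h3⟩ ∨
      c ⟨a, h1⟩ = c ⟨a + 2 * d, h3⟩

/-- `g r A` is the number of rainbow 3-AP-free `r`-colorings of `A`. -/
noncomputable def g (r : ℕ) (A : Finset ℕ) : ℕ :=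
  Nat.card {c : A → Fin r // RainbowAPFree A c}


theorem code_count (r : ℕ) (γ : ℝ) (hγ : 0 < γ) :
    ∃ ε : ℝ, 0 < ε ∧ ∀ (V : Type) [Fintype V] [DecidableEq V] (n : ℕ), Fintype.card V ≤ n →
      ((Finset.univ.filter (fun u : V → Option (Fin r) =>
        ((Finset.univ.filter (fun x => u x ≠ none)).card : ℝ) ≤ ε * n)).card : ℝ)
        ≤ (2 : ℝ) ^ (γ * n) := by
  have hl2 : 0 < Real.log 2 := Real.log_pos (by norm_num)
  set t : ℝ := min (1/2) (γ * Real.log 2 / (2 * (r + 1))) with ht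
  have ht0 : 0 < t := by rw [ht]; positivity
  have ht1 : t ≤ 1/2 := min_le_left _ _
  have ht2 : r * t ≤ γ * Real.log 2 / 2 := by
    have h1 : t ≤ γ * Real.log 2 / (2 * (r + 1)) := min_le_right _ _
    rw [le_div_iff₀ (by positivity)] at h1
    nlinarith
  have hlt : Real.log t < 0 := Real.log_neg ht0 (by linarith)
  refine ⟨γ * Real.log 2 / (2 * (- Real.log t)), by have : 0 < - Real.log t := by linarith
                                                    positivity, ?_⟩
  intro V _ _ n hn
  set ε := γ * Real.log 2 / (2 * (- Real.log t)) with hε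
  set F := (Finset.univ.filter (fun u : V → Option (Fin r) =>
        ((Finset.univ.filter (fun x => u x ≠ none)).card : ℝ) ≤ ε * n)) with hF
  have hεl : ε * (- Real.log t) = γ * Real.log 2 / 2 := by
    have : Real.log t ≠ 0 := by linarith
    rw [hε]
    field_simp
  have hsum : ∑ u : V → Option (Fin r), ∏ x, (if u x ≠ none then t else 1)
      = (1 + r * t) ^ (Fintype.card V) := by
    have := (Finset.prod_univ_sum (fun _ : V => (Finset.univ : Finset (Option (Fin r))))
      (fun (_ : V) (o : Option (Fin r)) => if o ≠ none then t else 1)).symm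
    rw [Fintype.piFinset_univ] at this
    rw [this]
    simp [Fintype.sum_option]
  have hle : (F.card : ℝ) * Real.exp (ε * n * Real.log t) ≤ (1 + r * t) ^ (Fintype.card V) := by
    rw [← hsum, ← nsmul_eq_mul, ← Finset.sum_const]
    refine le_trans (Finset.sum_le_sum (f := fun _ => Real.exp (ε * n * Real.log t)) (g := fun u : V → Option (Fin r) => ∏ x, (if u x ≠ none then t else 1)) ?_)
      (Finset.sum_le_sum_of_subset_of_nonneg (Finset.subset_univ F) ?_)
    · intro u hu
      rw [hF, Finset.mem_filter] at hu
      rw [Finset.prod_ite]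
      simp only [Finset.prod_const, one_pow, mul_one]
      rw [← Real.exp_log (pow_pos ht0 _), Real.log_pow]
      apply Real.exp_le_exp.2
      exact mul_le_mul_of_nonpos_right hu.2 hlt.le
    · intro u _ _
      apply Finset.prod_nonneg; intro x _; split_ifs <;> linarith
  have h2 : (1 + r * t) ^ (Fintype.card V) ≤ Real.exp (r * t * n) := by
    calc (1 + r * t) ^ (Fintype.card V) ≤ (1 + r * t) ^ n :=
          pow_le_pow_right₀ (by nlinarith [show (0:ℝ) ≤ r from Nat.cast_nonneg r]) hn
      _ ≤ (Real.exp (r * t)) ^ n := by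
          apply pow_le_pow_left₀ (by positivity)
          linarith [Real.add_one_le_exp (r * t)]
      _ = _ := by rw [← Real.exp_nat_mul]; ring_nf
  rw [Real.rpow_def_of_pos (by norm_num)]
  have h3 : (F.card : ℝ) ≤ Real.exp (r * t * n) * Real.exp (- (ε * n * Real.log t)) := by
    rw [Real.exp_neg, ← div_eq_mul_inv, le_div_iff₀ (Real.exp_pos _)]
    linarith
  rw [← Real.exp_add] at h3
  refine h3.trans (Real.exp_le_exp.2 ?_)
  have hn0 : (0:ℝ) ≤ n := Nat.cast_nonneg n
  nlinarith

theorem hit_one {ι V : Type} [DecidableEq V] [DecidableEq ι] [Fintype V] (J : Finset ι) (B : ι → Finset V) (n b : ℝ)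
    (hn : (Fintype.card V : ℝ) ≤ n) (hb : 0 < b) (hbn : b ≤ n) (hB : ∀ j ∈ J, b ≤ (B j).card) (k : ℕ) :
    ∃ Y : Finset V, Y.card ≤ k ∧
      ((J.filter (fun j => Disjoint (B j) Y)).card : ℝ) ≤ J.card * (1 - b / n) ^ k := by
  have hn0 : 0 < n := by linarith
  induction k with
  | zero => exact ⟨∅, by simp, by simp⟩
  | succ k ih =>
    obtain ⟨Y, hY, hU⟩ := ih
    set U := J.filter (fun j => Disjoint (B j) Y) with hUdef
    have hq : 0 ≤ 1 - b / n := by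
      rw [sub_nonneg, div_le_one hn0]; exact hbn
    by_cases hUe : U = ∅
    · refine ⟨Y, by omega, ?_⟩
      rw [← hUdef, hUe]; simp; positivity
    have hV : Nonempty V := by
      obtain ⟨j, hj⟩ := Finset.nonempty_iff_ne_empty.2 hUe
      have := hB j (Finset.mem_filter.1 hj).1
      have h0 : 0 < (B j).card := by
        have : (0:ℝ) < (B j).card := by linarith
        exact_mod_cast this
      obtain ⟨v, _⟩ := Finset.card_pos.1 h0
      exact ⟨v⟩
    have key : ∃ v : V, b / n * U.card ≤ ((U.filter (fun j => v ∈ B j)).card : ℝ) := by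
      by_contra hcon
      push Not at hcon
      have h1 : ∑ v : V, ((U.filter (fun j => v ∈ B j)).card : ℝ) = ∑ j ∈ U, ((B j).card : ℝ) := by
        have : ∀ v : V, ((U.filter (fun j => v ∈ B j)).card : ℝ) = ∑ j ∈ U, if v ∈ B j then (1:ℝ) else 0 := by
          intro v; simp
        simp_rw [this]
        rw [Finset.sum_comm]
        apply Finset.sum_congr rfl
        intro j _
        simp
      have h2 : (U.card : ℝ) * b ≤ ∑ j ∈ U, ((B j).card : ℝ) := by
        rw [← nsmul_eq_mul]
        apply Finset.card_nsmul_le_sum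
        intro j hj
        exact hB j (Finset.mem_filter.1 hj).1
      have h3 : ∑ v : V, ((U.filter (fun j => v ∈ B j)).card : ℝ) < ∑ v : V, b / n * U.card := by
        apply Finset.sum_lt_sum_of_nonempty
        · exact Finset.univ_nonempty
        · intro v _; exact hcon v
      rw [Finset.sum_const, nsmul_eq_mul, Finset.card_univ] at h3
      have h4 : (Fintype.card V : ℝ) * (b / n * U.card) ≤ n * (b / n * U.card) := by
        apply mul_le_mul_of_nonneg_right hn; positivity
      have h5 : n * (b / n * U.card) = b * U.card := by field_simp
      linarith
    obtain ⟨v, hv⟩ := key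
    refine ⟨insert v Y, (Finset.card_insert_le _ _).trans (by omega), ?_⟩
    have hsub : J.filter (fun j => Disjoint (B j) (insert v Y)) = U.filter (fun j => ¬ v ∈ B j) := by
      ext j
      simp only [hUdef, Finset.mem_filter, Finset.disjoint_insert_right]
      tauto
    rw [hsub]
    have hc := Finset.card_filter_add_card_filter_not (s := U) (fun j => v ∈ B j)
    have hc' : ((U.filter (fun j => v ∈ B j)).card : ℝ) + ((U.filter (fun j => ¬ v ∈ B j)).card : ℝ) = U.card := by
      exact_mod_cast hc
    calc ((U.filter (fun j => ¬ v ∈ B j)).card : ℝ) ≤ U.card * (1 - b / n) := by linarith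
      _ ≤ (J.card * (1 - b / n) ^ k) * (1 - b / n) := mul_le_mul_of_nonneg_right hU hq
      _ = _ := by ring

theorem hit_many {ι V : Type} [DecidableEq V] [DecidableEq ι] [Fintype V] (J : Finset ι) (B : ι → Finset V) (n b : ℝ)
    (hn : (Fintype.card V : ℝ) ≤ n) (hb : 0 < b) (hbn : b ≤ n) (k D : ℕ)
    (hB : ∀ j ∈ J, b + D * k ≤ (B j).card) :
    ∃ Y : Finset V, Y.card ≤ D * k ∧
      ((J.filter (fun j => ((B j) ∩ Y).card < D)).card : ℝ) ≤ D * (J.card * (1 - b / n) ^ k) := by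
  induction D with
  | zero => exact ⟨∅, by simp, by simp⟩
  | succ D ih =>
    have hk0 : (0:ℝ) ≤ k := Nat.cast_nonneg k
    obtain ⟨Y, hY, hU⟩ := ih (fun j hj => by have := hB j hj; push_cast at this; nlinarith)
    obtain ⟨Z, hZ, hU2⟩ := hit_one J (fun j => B j \ Y) n b hn hb hbn (by
      intro j hj
      have h1 := hB j hj
      have h2 : (B j).card ≤ (B j \ Y).card + Y.card := by
        have := Finset.le_card_sdiff Y (B j)
        omega
      have h3 : ((B j).card : ℝ) ≤ (B j \ Y).card + Y.card := by exact_mod_cast h2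
      have h4 : (Y.card : ℝ) ≤ D * k := by exact_mod_cast hY
      push_cast at h1
      nlinarith) k
    refine ⟨Y ∪ Z, (Finset.card_union_le _ _).trans (by nlinarith), ?_⟩
    have hsub : J.filter (fun j => ((B j) ∩ (Y ∪ Z)).card < D + 1) ⊆
        J.filter (fun j => ((B j) ∩ Y).card < D) ∪ J.filter (fun j => Disjoint (B j \ Y) Z) := by
      intro j hj
      simp only [Finset.mem_filter, Finset.mem_union] at hj ⊢
      by_contra hcon
      push Not at hcon
      have h1 := hcon.1 hj.1
      have h2 := hcon.2 hj.1
      rw [Finset.not_disjoint_iff] at h2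
      obtain ⟨v, hv1, hv2⟩ := h2
      rw [Finset.mem_sdiff] at hv1
      have h3 : insert v (B j ∩ Y) ⊆ B j ∩ (Y ∪ Z) := by
        intro w hw
        simp only [Finset.mem_insert, Finset.mem_inter, Finset.mem_union] at hw ⊢
        rcases hw with rfl | hw
        · exact ⟨hv1.1, Or.inr hv2⟩
        · exact ⟨hw.1, Or.inl hw.2⟩
      have h4 := Finset.card_le_card h3
      rw [Finset.card_insert_of_notMem (by simp [hv1.2])] at h4
      omega
    have h5 := (Finset.card_le_card hsub).trans (Finset.card_union_le _ _)
    have h6 : ((J.filter (fun j => ((B j) ∩ (Y ∪ Z)).card < D + 1)).card : ℝ) ≤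
      (J.filter (fun j => ((B j) ∩ Y).card < D)).card + (J.filter (fun j => Disjoint (B j \ Y) Z)).card := by
      exact_mod_cast h5
    push_cast
    nlinarith

/-- three colors pairwise distinct -/
def Rb {r : ℕ} (i j k : Fin r) : Prop := i ≠ j ∧ j ≠ k ∧ i ≠ k

/-- `T x y z` holds and the three palettes allow a rainbow choice -/
def RT {r : ℕ} {V : Type} (T : V → V → V → Prop) (Q1 Q2 Q3 : V → Finset (Fin r)) (x y z : V) : Prop :=
  T x y z ∧ ∃ i ∈ Q1 x, ∃ j ∈ Q2 y, ∃ k ∈ Q3 z, Rb i j k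

/-- codegrees at most three -/
structure Codeg {V : Type} [Fintype V] (T : V → V → V → Prop) : Prop where
  hz : ∀ x y, ∃ s : Finset V, s.card ≤ 3 ∧ ∀ z, T x y z → z ∈ s
  hy : ∀ x z, ∃ s : Finset V, s.card ≤ 3 ∧ ∀ y, T x y z → y ∈ s
  hx : ∀ y z, ∃ s : Finset V, s.card ≤ 3 ∧ ∀ x, T x y z → x ∈ s

open Classical in
/-- number of ordered rainbow triples -/
noncomputable def NT {r : ℕ} {V : Type} [Fintype V] (T : V → V → V → Prop)
    (Q1 Q2 Q3 : V → Finset (Fin r)) : ℕ :=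
  (Finset.univ.filter (fun p : V × V × V => RT T Q1 Q2 Q3 p.1 p.2.1 p.2.2)).card

/-- the template of a coloring -/
def single {r : ℕ} {V : Type} (c : V → Fin r) : V → Finset (Fin r) := fun x => {c x}

open Classical in
/-- restriction of a coloring to a set -/
noncomputable def res {r : ℕ} {V : Type} (c : V → Fin r) (S : Finset V) : V → Option (Fin r) :=
  fun x => if x ∈ S then some (c x) else none

open Classical in
theorem pair_le {X Y : Type} [Fintype X] [Fintype Y] (S : X → Y → Prop)
    (h : ∀ x, ∃ s : Finset Y, s.card ≤ 3 ∧ ∀ y, S x y → y ∈ s) :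
    (Finset.univ.filter (fun q : X × Y => S q.1 q.2)).card ≤
      3 * (Finset.univ.filter (fun x : X => ∃ y, S x y)).card := by
  rw [mul_comm]
  refine le_trans (Finset.card_le_card (t := (Finset.univ.filter (fun x : X => ∃ y, S x y)).biUnion
    (fun x => (Finset.univ.filter (fun y => S x y)).image (fun y => (x, y)))) ?_) ?_
  · rintro ⟨x, y⟩ hq
    simp only [Finset.mem_filter, Finset.mem_univ, true_and] at hq
    simp only [Finset.mem_biUnion, Finset.mem_filter, Finset.mem_univ, true_and, Finset.mem_image]
    exact ⟨x, ⟨y, hq⟩, y, hq, rfl⟩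
  · apply Finset.card_biUnion_le_card_mul
    intro x _
    refine Finset.card_image_le.trans ?_
    obtain ⟨s, hs, hs2⟩ := h x
    refine le_trans (Finset.card_le_card ?_) hs
    intro y hy
    exact hs2 y (Finset.mem_filter.1 hy).2

open Classical in
theorem tri_x {V : Type} [Fintype V] (S : V → V → V → Prop) :
    (Finset.univ.filter (fun p : V × V × V => S p.1 p.2.1 p.2.2)).card =
      ∑ x, (Finset.univ.filter (fun q : V × V => S x q.1 q.2)).card := by
  simp only [Finset.card_filter]
  rw [Fintype.sum_prod_type]

open Classical in
theorem tri_y {V : Type} [Fintype V] (S : V → V → V → Prop) :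
    (Finset.univ.filter (fun p : V × V × V => S p.1 p.2.1 p.2.2)).card =
      ∑ y, (Finset.univ.filter (fun q : V × V => S q.1 y q.2)).card := by
  simp only [Finset.card_filter, Fintype.sum_prod_type]
  rw [Finset.sum_comm]

open Classical in
theorem tri_z {V : Type} [Fintype V] (S : V → V → V → Prop) :
    (Finset.univ.filter (fun p : V × V × V => S p.1 p.2.1 p.2.2)).card =
      ∑ z, (Finset.univ.filter (fun q : V × V => S q.1 q.2 z)).card := by
  simp only [Finset.card_filter, Fintype.sum_prod_type]
  rw [Finset.sum_congr rfl (fun x _ => Finset.sum_comm)]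
  rw [Finset.sum_comm]

theorem row_bound {V : Type} [Fintype V] [DecidableEq V] (f : V → ℕ) (W : Finset V) (n : ℕ) (a η : ℝ)
    (ha : 0 ≤ a) (hV : Fintype.card V ≤ n) (hW : (W.card : ℝ) ≤ η * n)
    (h1 : ∀ x, x ∉ W → (f x : ℝ) ≤ a * n) (h2 : ∀ x, f x ≤ 3 * n) :
    ((∑ x, f x : ℕ) : ℝ) ≤ (a + 3 * η) * n ^ 2 := by
  have hpt : ∀ x, (f x : ℝ) ≤ a * n + (if x ∈ W then (3 * n : ℝ) else 0) := by
    intro x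
    by_cases hx : x ∈ W
    · have : (f x : ℝ) ≤ 3 * n := by exact_mod_cast h2 x
      simp only [hx, if_true]
      have : 0 ≤ a * n := by positivity
      linarith
    · simp only [hx, if_false, add_zero]; exact h1 x hx
  push_cast
  calc ∑ x, (f x : ℝ) ≤ ∑ x, (a * n + (if x ∈ W then (3 * n : ℝ) else 0)) :=
        Finset.sum_le_sum (fun x _ => hpt x)
    _ = Fintype.card V * (a * n) + W.card * (3 * n) := by
        rw [Finset.sum_add_distrib]; simp
    _ ≤ n * (a * n) + (η * n) * (3 * n) := by
        have hV' : (Fintype.card V : ℝ) ≤ n := by exact_mod_cast hV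
        gcongr
    _ = _ := by ring

open Classical in
theorem col_bound {r : ℕ} {X : Type} [Fintype X] (Q : Finset (Fin r)) (S : Fin r → X → Prop) (a : ℝ)
    (h : ∀ i ∈ Q, ((Finset.univ.filter (S i)).card : ℝ) ≤ a) (ha : 0 ≤ a) :
    ((Finset.univ.filter (fun q => ∃ i ∈ Q, S i q)).card : ℝ) ≤ r * a := by
  have h1 : (Finset.univ.filter (fun q => ∃ i ∈ Q, S i q)) ⊆ Q.biUnion (fun i => Finset.univ.filter (S i)) := by
    intro q hq
    simpa using hq
  have h2 := (Finset.card_le_card h1).trans Finset.card_biUnion_le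
  calc ((Finset.univ.filter (fun q => ∃ i ∈ Q, S i q)).card : ℝ)
      ≤ ((∑ i ∈ Q, (Finset.univ.filter (S i)).card : ℕ) : ℝ) := by exact_mod_cast h2
    _ = ∑ i ∈ Q, ((Finset.univ.filter (S i)).card : ℝ) := by push_cast; rfl
    _ ≤ Q.card * a := by rw [← nsmul_eq_mul]; exact Finset.sum_le_card_nsmul _ _ _ h
    _ ≤ r * a := by
        have : Q.card ≤ r := by simpa using Finset.card_le_univ Q
        have : (Q.card : ℝ) ≤ r := by exact_mod_cast this
        gcongr

open Classical in
/-- first round of the container algorithm -/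
noncomputable def F1 {r : ℕ} {V : Type} (T : V → V → V → Prop) (u w : V → Option (Fin r)) :
    V → Finset (Fin r) :=
  fun x => match w x with
    | some k => {k}
    | none => Finset.univ.filter (fun i => ¬ ∃ y z j k, u y = some j ∧ u z = some k ∧ T x y z ∧ Rb i j k)

theorem res_eq_some {r : ℕ} {V : Type} (c : V → Fin r) (S : Finset V) (x : V) (k : Fin r) :
    res c S x = some k ↔ x ∈ S ∧ c x = k := by
  unfold res; split_ifs with h <;> simp [h]

open Classical in
set_option maxHeartbeats 1000000 in
theorem round1 (r : ℕ) (δ ε : ℝ) (hδ : 0 < δ) (hε : 0 < ε) :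
    ∃ n₀ : ℕ, ∀ n, n₀ ≤ n → ∀ (V : Type) [Fintype V] (T : V → V → V → Prop), Codeg T →
      Fintype.card V ≤ n → ∀ c : V → Fin r, (∀ x y z, T x y z → ¬ Rb (c x) (c y) (c z)) →
      ∃ S W : Finset V, (S.card : ℝ) ≤ ε * n ∧ (W.card : ℝ) ≤ ε * n ∧
        (∀ x, c x ∈ F1 T (res c S) (res c W) x) ∧
        (NT T (F1 T (res c S) (res c W)) (single c) (single c) : ℝ) ≤ δ * n ^ 2 := by
  obtain ⟨η, hη0, hηε, hηδ⟩ : ∃ η : ℝ, 0 < η ∧ η ≤ ε ∧ η ≤ δ / 6 :=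
    ⟨min ε (δ / 6), by positivity, min_le_left _ _, min_le_right _ _⟩
  obtain ⟨a, ha0, ha1, haδ⟩ : ∃ a : ℝ, 0 < a ∧ a ≤ 1 ∧ r * a ≤ δ / 2 := by
    refine ⟨min 1 (δ / (2 * (r + 1))), by positivity, min_le_left _ _, ?_⟩
    have h : min 1 (δ / (2 * (r + 1))) ≤ δ / (2 * (r + 1)) := min_le_right _ _
    rw [le_div_iff₀ (by positivity)] at h
    have : 0 < min 1 (δ / (2 * ((r:ℝ) + 1))) := by positivity
    nlinarith
  obtain ⟨D, hD⟩ := exists_pow_lt_of_lt_one (show 0 < η / (2 * (r + 1)) by positivity)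
    (show Real.exp (- (ε / 12)) < 1 by rw [Real.exp_lt_one_iff]; linarith)
  obtain ⟨k1, hk1⟩ := exists_pow_lt_of_lt_one (show 0 < η / (2 * (r + 1) * (D + 1)) by positivity)
    (show 1 - a / 6 < 1 by linarith)
  obtain ⟨n₀, hn₀⟩ := exists_nat_ge (max (D + 1 : ℝ) (max (D * k1 * (6 / a)) (max (D * k1 * (2 / ε)) (4 / ε))))
  refine ⟨n₀, ?_⟩
  intro n hn V _ T hT hV c hc
  have hnr : (n₀ : ℝ) ≤ n := by exact_mod_cast hn
  have hb := hn₀.trans hnr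
  simp only [max_le_iff] at hb
  obtain ⟨hb1, hb2, hb3, hb4⟩ := hb
  have hD0 : (0:ℝ) ≤ D := Nat.cast_nonneg D
  have hr0 : (0:ℝ) ≤ r := Nat.cast_nonneg r
  have hn0 : (0:ℝ) < n := by linarith
  have hVr : (Fintype.card V : ℝ) ≤ n := by exact_mod_cast hV
  have e2 : (D * k1 : ℝ) ≤ a * n / 6 := by
    rw [← mul_div_assoc, div_le_iff₀ ha0] at hb2; linarith
  have e3 : (D * k1 : ℝ) ≤ ε * n / 2 := by
    rw [← mul_div_assoc, div_le_iff₀ hε] at hb3; linarith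
  have e4 : 1 ≤ ε * n / 4 := by
    rw [div_le_iff₀ hε] at hb4; linarith
  -- the link relation
  obtain ⟨Lk, hLk⟩ : ∃ Lk : V × Fin r → V → V → Prop,
      ∀ p y z, Lk p y z ↔ T p.1 y z ∧ Rb p.2 (c y) (c z) := ⟨_, fun _ _ _ => Iff.rfl⟩
  let J : Finset (V × Fin r) := Finset.univ.filter (fun p =>
    a * n < ((Finset.univ.filter (fun q : V × V => Lk p q.1 q.2)).card : ℝ))
  let B : V × Fin r → Finset V := fun p => Finset.univ.filter (fun y => ∃ z, Lk p y z)
  have hJ : (J.card : ℝ) ≤ n * r := by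
    have : J.card ≤ Fintype.card V * r := by
      refine (Finset.card_le_univ J).trans ?_
      simp
    calc (J.card : ℝ) ≤ Fintype.card V * r := by exact_mod_cast this
      _ ≤ n * r := by gcongr
  have hBJ : ∀ p ∈ J, a * n / 6 + D * k1 ≤ (B p).card := by
    intro p hp
    have h1 := (Finset.mem_filter.1 hp).2
    have h2 := pair_le (fun y z => Lk p y z) (fun y => by
      obtain ⟨s, hs, hs2⟩ := hT.hz p.1 y
      exact ⟨s, hs, fun z hz => hs2 z ((hLk _ _ _).1 hz).1⟩)
    have h3 : ((Finset.univ.filter (fun q : V × V => Lk p q.1 q.2)).card : ℝ) ≤ 3 * (B p).card := by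
      have h2' : (Finset.univ.filter (fun q : V × V => Lk p q.1 q.2)).card ≤ 3 * (B p).card := h2
      exact_mod_cast h2'
    linarith
  obtain ⟨Y, hY, hYU⟩ := hit_many J B n (a * n / 6) hVr (by positivity) (by nlinarith) k1 D hBJ
  let J2 := J.filter (fun p => ¬ ((B p) ∩ Y).card < D)
  let B2 : V × Fin r → Finset V := fun p => Finset.univ.filter (fun z => ∃ y ∈ Y, Lk p y z)
  set k2 := ⌊ε * n / 2⌋₊ with hk2
  have hk2a : (k2 : ℝ) ≤ ε * n / 2 := Nat.floor_le (by positivity)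
  have hk2b : ε * n / 4 ≤ k2 := by
    have := Nat.lt_floor_add_one (ε * n / 2); rw [← hk2] at this; linarith
  have hB2 : ∀ p ∈ J2, (D : ℝ) / 3 ≤ (B2 p).card := by
    intro p hp
    have h1 := (Finset.mem_filter.1 hp).2
    have h2 : ((B p) ∩ Y).card ≤ (B2 p).card * 3 := by
      choose s hs hs2 using hT.hy p.1
      refine le_trans (Finset.card_le_card (t := (B2 p).biUnion s) ?_)
        (Finset.card_biUnion_le_card_mul _ _ _ (fun z _ => hs z))
      intro y hy
      rw [Finset.mem_inter] at hy
      obtain ⟨z, hz⟩ := (Finset.mem_filter.1 hy.1).2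
      rw [Finset.mem_biUnion]
      exact ⟨z, Finset.mem_filter.2 ⟨Finset.mem_univ _, y, hy.2, hz⟩, hs2 z y ((hLk _ _ _).1 hz).1⟩
    have h3 : D ≤ (B2 p).card * 3 := by omega
    have h4 : (D : ℝ) ≤ (B2 p).card * 3 := by exact_mod_cast h3
    linarith
  have hZex : ∃ Z : Finset V, Z.card ≤ k2 ∧
      ((J2.filter (fun j => Disjoint (B2 j) Z)).card : ℝ) ≤ n * η / 2 := by
    rcases Nat.eq_zero_or_pos D with hD00 | hDpos
    · refine ⟨∅, by simp, ?_⟩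
      subst hD00
      have h1 : ((J2.filter (fun j => Disjoint (B2 j) ∅)).card : ℝ) ≤ J.card := by
        exact_mod_cast (Finset.card_filter_le _ _).trans (Finset.card_filter_le _ _)
      rw [pow_zero, lt_div_iff₀ (by positivity)] at hD
      nlinarith
    · have hDp : (0:ℝ) < D := by exact_mod_cast hDpos
      obtain ⟨Z, hZ, hZU⟩ := hit_one J2 B2 n (D / 3) hVr (by positivity) (by linarith) hB2 k2
      refine ⟨Z, hZ, hZU.trans ?_⟩
      have h1 : (1 - (D / 3 : ℝ) / n) ^ k2 ≤ Real.exp (- (ε / 12)) ^ D := by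
        have hx : 0 ≤ 1 - (D / 3 : ℝ) / n := by
          rw [sub_nonneg, div_le_one hn0]; linarith
        calc (1 - (D / 3 : ℝ) / n) ^ k2 ≤ (Real.exp (- ((D / 3 : ℝ) / n))) ^ k2 := by
              apply pow_le_pow_left₀ hx
              linarith [Real.add_one_le_exp (- ((D / 3 : ℝ) / n))]
          _ = Real.exp (- (k2 * ((D / 3 : ℝ) / n))) := by rw [← Real.exp_nat_mul]; ring_nf
          _ ≤ Real.exp (D * (- (ε / 12))) := by
              apply Real.exp_le_exp.2
              have : ε * n / 4 * ((D / 3 : ℝ) / n) ≤ k2 * ((D / 3 : ℝ) / n) := by gcongr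
              have h : ε * n / 4 * ((D / 3 : ℝ) / n) = D * (ε / 12) := by field_simp; norm_num
              linarith
          _ = _ := by rw [← Real.exp_nat_mul]
      have h2 : (J2.card : ℝ) ≤ n * r := by
        refine le_trans ?_ hJ
        exact_mod_cast Finset.card_filter_le _ _
      have h3 : (1 - (D / 3 : ℝ) / n) ^ k2 ≤ η / (2 * (r + 1)) := h1.trans hD.le
      have hx : 0 ≤ 1 - (D / 3 : ℝ) / n := by
        rw [sub_nonneg, div_le_one hn0]; linarith
      calc (J2.card : ℝ) * (1 - (D / 3 : ℝ) / n) ^ k2 ≤ (n * r) * (η / (2 * (r + 1))) := by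
            gcongr
        _ ≤ n * η / 2 := by
            rw [← mul_div_assoc, div_le_div_iff₀ (by positivity) (by norm_num)]
            nlinarith [mul_pos hn0 hη0]
  obtain ⟨Z, hZ, hZU⟩ := hZex
  let S := Y ∪ Z
  let bad := J.filter (fun p => ((B p) ∩ Y).card < D) ∪ J2.filter (fun j => Disjoint (B2 j) Z)
  let W : Finset V := bad.image Prod.fst
  have hYU2 : ((J.filter (fun p => ((B p) ∩ Y).card < D)).card : ℝ) ≤ n * η / 2 := by
    refine hYU.trans ?_
    have h1 : a * n / 6 / n = a / 6 := by field_simp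
    rw [h1]
    have hx : 0 ≤ 1 - a / 6 := by linarith
    calc (D : ℝ) * (J.card * (1 - a / 6) ^ k1) ≤ D * ((n * r) * (η / (2 * (r + 1) * (D + 1)))) := by
          gcongr
      _ ≤ n * η / 2 := by
          rw [← mul_div_assoc, ← mul_div_assoc, div_le_div_iff₀ (by positivity) (by norm_num)]
          have := mul_pos hn0 hη0
          have h5 : (D:ℝ) * r ≤ (D + 1) * (r + 1) :=
            mul_le_mul (by linarith) (by linarith) hr0 (by linarith)
          have h6 := mul_le_mul_of_nonneg_left h5 this.le
          linarith
  have hWc : (W.card : ℝ) ≤ η * n := by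
    have h1 : W.card ≤ (J.filter (fun p => ((B p) ∩ Y).card < D)).card + (J2.filter (fun j => Disjoint (B2 j) Z)).card :=
      Finset.card_image_le.trans (Finset.card_union_le _ _)
    have h2 : (W.card : ℝ) ≤ (J.filter (fun p => ((B p) ∩ Y).card < D)).card + (J2.filter (fun j => Disjoint (B2 j) Z)).card := by
      exact_mod_cast h1
    linarith
  refine ⟨S, W, ?_, hWc.trans (by gcongr), ?_, ?_⟩
  · have h1 : S.card ≤ D * k1 + k2 := (Finset.card_union_le _ _).trans (by omega)
    have h2 : (S.card : ℝ) ≤ D * k1 + k2 := by exact_mod_cast h1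
    linarith
  · intro x
    unfold F1
    by_cases hx : x ∈ W
    · simp [res, hx]
    · simp only [res_eq_some]
      simp only [res, hx, if_false, Finset.mem_filter, Finset.mem_univ, true_and]
      rintro ⟨y, z, j, k, ⟨-, rfl⟩, ⟨-, rfl⟩, ht, hrb⟩
      exact hc x y z ht hrb
  · unfold NT
    rw [tri_x (fun x y z => RT T (F1 T (res c S) (res c W)) (single c) (single c) x y z)]
    refine (row_bound _ W n (r * a) η (by positivity) hV hWc ?_ ?_).trans ?_
    · intro x hx
      rw [mul_assoc]
      refine le_trans ?_ (col_bound (F1 T (res c S) (res c W) x) (fun i (q : V × V) => Lk (x, i) q.1 q.2) (a * n) ?_ (by positivity))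
      · norm_cast
        apply Finset.card_le_card
        intro q hq
        simp only [Finset.mem_filter, Finset.mem_univ, true_and, RT, single, Finset.mem_singleton] at hq ⊢
        obtain ⟨ht, i, hi, j, rfl, k, rfl, hrb⟩ := hq
        exact ⟨i, hi, (hLk _ _ _).2 ⟨ht, hrb⟩⟩
      · intro i hi
        by_contra hcon
        push Not at hcon
        have hiJ : (x, i) ∈ J := Finset.mem_filter.2 ⟨Finset.mem_univ _, hcon⟩
        have hnb : (x, i) ∉ bad := fun h => hx (Finset.mem_image_of_mem Prod.fst h)
        simp only [bad, J2, Finset.mem_union, Finset.mem_filter, hiJ, true_and, not_or, not_and] at hnb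
        have h2 := hnb.2 hnb.1
        rw [Finset.not_disjoint_iff] at h2
        obtain ⟨z, hz1, hz2⟩ := h2
        obtain ⟨y, hy, hl⟩ := (Finset.mem_filter.1 hz1).2
        rw [hLk] at hl
        unfold F1 at hi
        simp only [res_eq_some] at hi
        simp only [res, hx, if_false, Finset.mem_filter, Finset.mem_univ, true_and] at hi
        exact hi ⟨y, z, c y, c z, ⟨Finset.mem_union_left _ hy, rfl⟩, ⟨Finset.mem_union_right _ hz2, rfl⟩, hl.1, hl.2⟩
    · intro x
      have h := pair_le (fun y z => RT T (F1 T (res c S) (res c W)) (single c) (single c) x y z) (fun y => by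
        obtain ⟨s, hs, hs2⟩ := hT.hz x y
        exact ⟨s, hs, fun z hz => hs2 z hz.1⟩)
      refine h.trans (Nat.mul_le_mul_left 3 ((Finset.card_le_univ _).trans hV))
    · have : (r * a + 3 * η) ≤ δ := by linarith
      gcongr

open Classical in
theorem pair_le' {X Y : Type} [Fintype X] [Fintype Y] (S : X → Y → Prop)
    (h : ∀ y, ∃ s : Finset X, s.card ≤ 3 ∧ ∀ x, S x y → x ∈ s) :
    (Finset.univ.filter (fun q : X × Y => S q.1 q.2)).card ≤
      3 * (Finset.univ.filter (fun y : Y => ∃ x, S x y)).card := by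
  refine le_trans ?_ (pair_le (fun y x => S x y) h)
  apply Finset.card_le_card_of_injOn Prod.swap
  · intro q hq; simpa using hq
  · intro a _ b _ hab; exact Prod.swap_injective hab

open Classical in
/-- second round of the container algorithm -/
noncomputable def F2 {r : ℕ} {V : Type} (T : V → V → V → Prop) (Q1 : V → Finset (Fin r))
    (u w : V → Option (Fin r)) : V → Finset (Fin r) :=
  fun y => match w y with
    | some k => {k}
    | none => Finset.univ.filter (fun j => ¬ ∃ x z i k, u z = some k ∧ i ∈ Q1 x ∧ T x y z ∧ Rb i j k)

open Classical in
set_option maxHeartbeats 1000000 in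
theorem round2 (r : ℕ) (δ ε : ℝ) (hδ : 0 < δ) (hε : 0 < ε) :
    ∃ δ₁ : ℝ, 0 < δ₁ ∧ ∃ n₀ : ℕ, ∀ n, n₀ ≤ n → ∀ (V : Type) [Fintype V] (T : V → V → V → Prop), Codeg T →
      Fintype.card V ≤ n → ∀ c : V → Fin r, ∀ Q1 : V → Finset (Fin r),
      (NT T Q1 (single c) (single c) : ℝ) ≤ δ₁ * n ^ 2 →
      ∃ S W : Finset V, (S.card : ℝ) ≤ ε * n ∧ (W.card : ℝ) ≤ ε * n ∧
        (∀ x, c x ∈ F2 T Q1 (res c S) (res c W) x) ∧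
        (NT T Q1 (F2 T Q1 (res c S) (res c W)) (single c) : ℝ) ≤ δ * n ^ 2 := by
  obtain ⟨η, hη0, hηε, hηδ⟩ : ∃ η : ℝ, 0 < η ∧ η ≤ ε ∧ η ≤ δ / 6 :=
    ⟨min ε (δ / 6), by positivity, min_le_left _ _, min_le_right _ _⟩
  obtain ⟨β, hβ0, hβ1, hβδ⟩ : ∃ a : ℝ, 0 < a ∧ a ≤ 1 ∧ r * (3 * a) ≤ δ / 2 := by
    refine ⟨min 1 (δ / (6 * (r + 1))), by positivity, min_le_left _ _, ?_⟩
    have h : min 1 (δ / (6 * (r + 1))) ≤ δ / (6 * (r + 1)) := min_le_right _ _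
    rw [le_div_iff₀ (by positivity)] at h
    have : 0 < min 1 (δ / (6 * ((r:ℝ) + 1))) := by positivity
    nlinarith
  obtain ⟨s, hs⟩ := exists_pow_lt_of_lt_one (show 0 < η / (2 * (r + 1)) by positivity)
    (show 1 - β / 2 < 1 by linarith)
  obtain ⟨τ, hτ0, hτ⟩ : ∃ τ : ℝ, 0 < τ ∧ s * τ ≤ η / 2 := by
    refine ⟨η / (2 * (s + 1)), by positivity, ?_⟩
    rw [← mul_div_assoc, div_le_div_iff₀ (by positivity) (by norm_num)]
    nlinarith
  refine ⟨β * τ / 2, by positivity, ?_⟩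
  obtain ⟨n₀, hn₀⟩ := exists_nat_ge (max 1 (s / ε))
  refine ⟨n₀, ?_⟩
  intro n hn V _ T hT hV c Q1 hN
  have hnr : (n₀ : ℝ) ≤ n := by exact_mod_cast hn
  have hb := hn₀.trans hnr
  simp only [max_le_iff] at hb
  obtain ⟨hb1, hb2⟩ := hb
  have hr0 : (0:ℝ) ≤ r := Nat.cast_nonneg r
  have hn0 : (0:ℝ) < n := by linarith
  have hVr : (Fintype.card V : ℝ) ≤ n := by exact_mod_cast hV
  have e2 : (s : ℝ) ≤ ε * n := by
    rw [div_le_iff₀ hε] at hb2; linarith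
  obtain ⟨G, hG⟩ : ∃ G : V × Fin r → V → Prop,
      ∀ p z, G p z ↔ ∃ x i, i ∈ Q1 x ∧ T x p.1 z ∧ Rb i p.2 (c z) := ⟨_, fun _ _ => Iff.rfl⟩
  let Wz : Finset V := Finset.univ.filter (fun z =>
    τ * n < ((Finset.univ.filter (fun y => G (y, c y) z)).card : ℝ))
  have hWz : (Wz.card : ℝ) ≤ β * n / 2 := by
    have h1 : (Wz.card : ℝ) * (τ * n) ≤ ∑ z, ((Finset.univ.filter (fun y => G (y, c y) z)).card : ℝ) := by
      rw [← nsmul_eq_mul]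
      refine le_trans (Finset.card_nsmul_le_sum Wz _ _ (fun z hz => (Finset.mem_filter.1 hz).2.le)) ?_
      exact Finset.sum_le_sum_of_subset_of_nonneg (Finset.subset_univ _) (fun _ _ _ => Nat.cast_nonneg _)
    have h2 : ∑ z, (Finset.univ.filter (fun y => G (y, c y) z)).card ≤ NT T Q1 (single c) (single c) := by
      unfold NT
      rw [tri_z (fun x y z => RT T Q1 (single c) (single c) x y z)]
      apply Finset.sum_le_sum
      intro z _
      refine le_trans (Finset.card_le_card ?_) (Finset.card_image_le (f := Prod.snd))
      intro y hy
      simp only [Finset.mem_filter, Finset.mem_univ, true_and, hG] at hy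
      obtain ⟨x, i, hi, ht, hrb⟩ := hy
      rw [Finset.mem_image]
      refine ⟨(x, y), ?_, rfl⟩
      simp only [Finset.mem_filter, Finset.mem_univ, true_and, RT, single, Finset.mem_singleton]
      exact ⟨ht, i, hi, _, rfl, _, rfl, hrb⟩
    have h3 : ∑ z, ((Finset.univ.filter (fun y => G (y, c y) z)).card : ℝ) ≤ NT T Q1 (single c) (single c) := by
      exact_mod_cast h2
    have h4 : (Wz.card : ℝ) * (τ * n) ≤ (β * n / 2) * (τ * n) := by
      have : β * τ / 2 * n ^ 2 = (β * n / 2) * (τ * n) := by ring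
      linarith
    exact le_of_mul_le_mul_right h4 (by positivity)
  let J : Finset (V × Fin r) := Finset.univ.filter (fun p =>
    β * n < ((Finset.univ.filter (fun z => G p z)).card : ℝ))
  let B : V × Fin r → Finset V := fun p => (Finset.univ.filter (fun z => G p z)) \ Wz
  have hJ : (J.card : ℝ) ≤ n * r := by
    have : J.card ≤ Fintype.card V * r := by
      refine (Finset.card_le_univ J).trans ?_
      simp
    calc (J.card : ℝ) ≤ Fintype.card V * r := by exact_mod_cast this
      _ ≤ n * r := by gcongr
  have hBJ : ∀ p ∈ J, β * n / 2 ≤ (B p).card := by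
    intro p hp
    have h1 := (Finset.mem_filter.1 hp).2
    have h2 : (Finset.univ.filter (fun z => G p z)).card ≤ (B p).card + Wz.card := by
      have := Finset.le_card_sdiff Wz (Finset.univ.filter (fun z => G p z))
      simp only [B]
      omega
    have h3 : ((Finset.univ.filter (fun z => G p z)).card : ℝ) ≤ (B p).card + Wz.card := by
      exact_mod_cast h2
    linarith
  obtain ⟨Y, hY, hYU⟩ := hit_one J B n (β * n / 2) hVr (by positivity) (by nlinarith) hBJ s
  let S := Y \ Wz
  let W1 : Finset V := S.biUnion (fun z => Finset.univ.filter (fun y => G (y, c y) z))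
  let W2 : Finset V := (J.filter (fun p => Disjoint (B p) Y)).image Prod.fst
  let W := W1 ∪ W2
  have hSs : S.card ≤ s := (Finset.card_le_card Finset.sdiff_subset).trans hY
  have hSr : (S.card : ℝ) ≤ s := by exact_mod_cast hSs
  have hW1 : (W1.card : ℝ) ≤ η * n / 2 := by
    have h1 : W1.card ≤ ∑ z ∈ S, (Finset.univ.filter (fun y => G (y, c y) z)).card := Finset.card_biUnion_le
    have h2 : (W1.card : ℝ) ≤ ∑ z ∈ S, ((Finset.univ.filter (fun y => G (y, c y) z)).card : ℝ) := by
      exact_mod_cast h1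
    have h3 : ∑ z ∈ S, ((Finset.univ.filter (fun y => G (y, c y) z)).card : ℝ) ≤ S.card • (τ * n) := by
      apply Finset.sum_le_card_nsmul
      intro z hz
      by_contra hcon
      push Not at hcon
      exact (Finset.mem_sdiff.1 hz).2 (Finset.mem_filter.2 ⟨Finset.mem_univ _, hcon⟩)
    rw [nsmul_eq_mul] at h3
    have h4 : (S.card : ℝ) * (τ * n) ≤ s * (τ * n) := by gcongr
    have h5 : s * τ * n ≤ η / 2 * n := by gcongr
    linarith
  have hW2 : (W2.card : ℝ) ≤ η * n / 2 := by
    have h0 : (W2.card : ℝ) ≤ (J.filter (fun p => Disjoint (B p) Y)).card := by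
      exact_mod_cast Finset.card_image_le
    refine h0.trans (hYU.trans ?_)
    have h1 : β * n / 2 / n = β / 2 := by field_simp
    rw [h1]
    have hx : 0 ≤ 1 - β / 2 := by linarith
    calc (J.card * (1 - β / 2) ^ s) ≤ ((n * r) * (η / (2 * (r + 1)))) := by
          gcongr
      _ ≤ η * n / 2 := by
          rw [← mul_div_assoc, div_le_div_iff₀ (by positivity) (by norm_num)]
          have := mul_pos hn0 hη0
          nlinarith
  have hWc : (W.card : ℝ) ≤ η * n := by
    have h2 : (W.card : ℝ) ≤ W1.card + W2.card := by
      exact_mod_cast Finset.card_union_le _ _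
    linarith
  refine ⟨S, W, by linarith, hWc.trans (by gcongr), ?_, ?_⟩
  · intro y
    unfold F2
    by_cases hy : y ∈ W
    · simp [res, hy]
    · simp only [res_eq_some]
      simp only [res, hy, if_false, Finset.mem_filter, Finset.mem_univ, true_and]
      rintro ⟨x, z, i, k, ⟨hz, rfl⟩, hi, ht, hrb⟩
      apply hy
      apply Finset.mem_union_left
      rw [Finset.mem_biUnion]
      exact ⟨z, hz, Finset.mem_filter.2 ⟨Finset.mem_univ _, (hG _ _).2 ⟨x, i, hi, ht, hrb⟩⟩⟩
  · unfold NT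
    rw [tri_y (fun x y z => RT T Q1 (F2 T Q1 (res c S) (res c W)) (single c) x y z)]
    refine (row_bound _ W n (r * (3 * β)) η (by positivity) hV hWc ?_ ?_).trans ?_
    · intro y hy
      rw [mul_assoc]
      refine le_trans ?_ (col_bound (F2 T Q1 (res c S) (res c W) y)
        (fun j (q : V × V) => T q.1 y q.2 ∧ ∃ i ∈ Q1 q.1, Rb i j (c q.2)) (3 * β * n) ?_ (by positivity))
      · norm_cast
        apply Finset.card_le_card
        intro q hq
        simp only [Finset.mem_filter, Finset.mem_univ, true_and, RT, single, Finset.mem_singleton] at hq ⊢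
        obtain ⟨ht, i, hi, j, hj, k, rfl, hrb⟩ := hq
        exact ⟨j, hj, ht, i, hi, hrb⟩
      · intro j hj
        have h := pair_le' (fun x z => T x y z ∧ ∃ i ∈ Q1 x, Rb i j (c z)) (fun z => by
          obtain ⟨s, hs, hs2⟩ := hT.hx y z
          exact ⟨s, hs, fun x hx => hs2 x hx.1⟩)
        have h' : ((Finset.univ.filter (fun q : V × V => T q.1 y q.2 ∧ ∃ i ∈ Q1 q.1, Rb i j (c q.2))).card : ℝ)
            ≤ 3 * ((Finset.univ.filter (fun z => G (y, j) z)).card : ℝ) := by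
          have h2 : (Finset.univ.filter (fun z : V => ∃ x, T x y z ∧ ∃ i ∈ Q1 x, Rb i j (c z))).card ≤
              (Finset.univ.filter (fun z => G (y, j) z)).card := by
            apply Finset.card_le_card
            intro z hz
            simp only [Finset.mem_filter, Finset.mem_univ, true_and, hG] at hz ⊢
            obtain ⟨x, ht, i, hi, hrb⟩ := hz
            exact ⟨x, i, hi, ht, hrb⟩
          have h3 := h.trans (Nat.mul_le_mul_left 3 (le_trans (le_of_eq (by congr!)) h2))
          refine le_trans (le_of_eq ?_) (by exact_mod_cast h3 : (((_ : ℕ)) : ℝ) ≤ _)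
          congr!
        refine le_trans (le_of_eq ?_) (h'.trans ?_)
        · congr!
        by_contra hcon
        push Not at hcon
        have hiJ : (y, j) ∈ J := Finset.mem_filter.2 ⟨Finset.mem_univ _, by nlinarith⟩
        have hnb : (y, j) ∉ J.filter (fun p => Disjoint (B p) Y) := fun h =>
          hy (Finset.mem_union_right _ (Finset.mem_image_of_mem Prod.fst h))
        simp only [Finset.mem_filter, hiJ, true_and] at hnb
        rw [Finset.not_disjoint_iff] at hnb
        obtain ⟨z, hz1, hz2⟩ := hnb
        obtain ⟨hz3, hz4⟩ := Finset.mem_sdiff.1 hz1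
        obtain ⟨x, i, hi, ht, hrb⟩ := (hG _ _).1 (Finset.mem_filter.1 hz3).2
        unfold F2 at hj
        simp only [res_eq_some] at hj
        simp only [res, hy, if_false, Finset.mem_filter, Finset.mem_univ, true_and] at hj
        exact hj ⟨x, z, i, c z, ⟨Finset.mem_sdiff.2 ⟨hz2, hz4⟩, rfl⟩, hi, ht, hrb⟩
    · intro y
      have h := pair_le (fun x z => RT T Q1 (F2 T Q1 (res c S) (res c W)) (single c) x y z) (fun x => by
        obtain ⟨s, hs, hs2⟩ := hT.hz x y
        exact ⟨s, hs, fun z hz => hs2 z hz.1⟩)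
      refine h.trans (Nat.mul_le_mul_left 3 ((Finset.card_le_univ _).trans hV))
    · have : (r * (3 * β) + 3 * η) ≤ δ := by linarith
      gcongr

open Classical in
/-- third round of the container algorithm -/
noncomputable def F3 {r : ℕ} {V : Type} [Fintype V] (T : V → V → V → Prop) (Q1 Q2 : V → Finset (Fin r))
    (θ : ℝ) (w : V → Option (Fin r)) : V → Finset (Fin r) :=
  fun z => match w z with
    | some k => {k}
    | none => Finset.univ.filter (fun k =>
        ((Finset.univ.filter (fun q : V × V => T q.1 q.2 z ∧ ∃ i ∈ Q1 q.1, ∃ j ∈ Q2 q.2, Rb i j k)).card : ℝ) ≤ θ)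

open Classical in
set_option maxHeartbeats 1000000 in
theorem round3 (r : ℕ) (δ ε : ℝ) (hδ : 0 < δ) (hε : 0 < ε) :
    ∃ δ₁ θ : ℝ, 0 < δ₁ ∧ 0 < θ ∧ ∀ n : ℕ, 1 ≤ n → ∀ (V : Type) [Fintype V] (T : V → V → V → Prop), Codeg T →
      Fintype.card V ≤ n → ∀ c : V → Fin r, ∀ Q1 Q2 : V → Finset (Fin r),
      (NT T Q1 Q2 (single c) : ℝ) ≤ δ₁ * n ^ 2 →
      ∃ W : Finset V, (W.card : ℝ) ≤ ε * n ∧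
        (∀ x, c x ∈ F3 T Q1 Q2 (θ * n) (res c W) x) ∧
        (NT T Q1 Q2 (F3 T Q1 Q2 (θ * n) (res c W)) : ℝ) ≤ δ * n ^ 2 := by
  obtain ⟨η, hη0, hηε, hηδ⟩ : ∃ η : ℝ, 0 < η ∧ η ≤ ε ∧ η ≤ δ / 6 :=
    ⟨min ε (δ / 6), by positivity, min_le_left _ _, min_le_right _ _⟩
  obtain ⟨θ, hθ0, hθδ⟩ : ∃ a : ℝ, 0 < a ∧ r * a ≤ δ / 2 := by
    refine ⟨δ / (2 * (r + 1)), by positivity, ?_⟩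
    rw [← mul_div_assoc, div_le_div_iff₀ (by positivity) (by norm_num)]
    nlinarith
  refine ⟨η * θ, θ, by positivity, hθ0, ?_⟩
  intro n hn V _ T hT hV c Q1 Q2 hN
  have hn0 : (0:ℝ) < n := by exact_mod_cast hn
  obtain ⟨M, hM⟩ : ∃ M : V → Fin r → V × V → Prop, ∀ z k q,
    M z k q ↔ (T q.1 q.2 z ∧ ∃ i ∈ Q1 q.1, ∃ j ∈ Q2 q.2, Rb i j k) := ⟨_, fun _ _ _ => Iff.rfl⟩
  let W : Finset V := Finset.univ.filter (fun z =>
    θ * n < ((Finset.univ.filter (M z (c z))).card : ℝ))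
  have hF : ∀ z, z ∉ W → ∀ k, k ∈ F3 T Q1 Q2 (θ * n) (res c W) z ↔
      ((Finset.univ.filter (M z k)).card : ℝ) ≤ θ * n := by
    intro z hz k
    unfold F3
    simp only [res, hz, if_false, Finset.mem_filter, Finset.mem_univ, true_and]
    have : (Finset.univ.filter (fun q : V × V => T q.1 q.2 z ∧ ∃ i ∈ Q1 q.1, ∃ j ∈ Q2 q.2, Rb i j k))
      = Finset.univ.filter (M z k) := by
      ext q; simp [hM]
    rw [this]
  have hWc : (W.card : ℝ) ≤ η * n := by
    have h1 : (W.card : ℝ) * (θ * n) ≤ ∑ z, ((Finset.univ.filter (M z (c z))).card : ℝ) := by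
      rw [← nsmul_eq_mul]
      refine le_trans (Finset.card_nsmul_le_sum W _ _ (fun z hz => (Finset.mem_filter.1 hz).2.le)) ?_
      exact Finset.sum_le_sum_of_subset_of_nonneg (Finset.subset_univ _) (fun _ _ _ => Nat.cast_nonneg _)
    have h2 : ∑ z, (Finset.univ.filter (M z (c z))).card ≤ NT T Q1 Q2 (single c) := by
      unfold NT
      rw [tri_z (fun x y z => RT T Q1 Q2 (single c) x y z)]
      apply Finset.sum_le_sum
      intro z _
      apply Finset.card_le_card
      intro q hq
      simp only [Finset.mem_filter, Finset.mem_univ, true_and, hM] at hq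
      obtain ⟨ht, i, hi, j, hj, hrb⟩ := hq
      simp only [Finset.mem_filter, Finset.mem_univ, true_and, RT, single, Finset.mem_singleton]
      exact ⟨ht, i, hi, _, hj, _, rfl, hrb⟩
    have h3 : ∑ z, ((Finset.univ.filter (M z (c z))).card : ℝ) ≤ NT T Q1 Q2 (single c) := by
      exact_mod_cast h2
    have h4 : (W.card : ℝ) * (θ * n) ≤ (η * n) * (θ * n) := by
      have : η * θ * n ^ 2 = (η * n) * (θ * n) := by ring
      linarith
    exact le_of_mul_le_mul_right h4 (by positivity)
  refine ⟨W, hWc.trans (by gcongr), ?_, ?_⟩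
  · intro z
    by_cases hz : z ∈ W
    · unfold F3; simp [res, hz]
    · rw [hF z hz]
      by_contra hcon
      push Not at hcon
      exact hz (Finset.mem_filter.2 ⟨Finset.mem_univ _, hcon⟩)
  · unfold NT
    rw [tri_z (fun x y z => RT T Q1 Q2 (F3 T Q1 Q2 (θ * n) (res c W)) x y z)]
    refine (row_bound _ W n (r * θ) η (by positivity) hV hWc ?_ ?_).trans ?_
    · intro z hz
      rw [mul_assoc]
      refine le_trans ?_ (col_bound (F3 T Q1 Q2 (θ * n) (res c W) z) (M z) (θ * n) ?_ (by positivity))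
      · norm_cast
        apply Finset.card_le_card
        intro q hq
        rw [Finset.mem_filter] at hq ⊢
        obtain ⟨-, ht, i, hi, j, hj, k, hk, hrb⟩ := hq
        exact ⟨Finset.mem_univ _, k, hk, (hM _ _ _).2 ⟨ht, i, hi, j, hj, hrb⟩⟩
      · intro k hk
        exact (hF z hz k).1 hk
    · intro z
      have h := pair_le (fun x y => RT T Q1 Q2 (F3 T Q1 Q2 (θ * n) (res c W)) x y z) (fun x => by
        obtain ⟨s, hs, hs2⟩ := hT.hy x z
        exact ⟨s, hs, fun z hz => hs2 z hz.1⟩)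
      refine h.trans (Nat.mul_le_mul_left 3 ((Finset.card_le_univ _).trans hV))
    · have : (r * θ + 3 * η) ≤ δ := by linarith
      gcongr

theorem NT_mono {r : ℕ} {V : Type} [Fintype V] (T : V → V → V → Prop) (P1 P2 P3 Q1 Q2 Q3 : V → Finset (Fin r))
    (h1 : ∀ x, P1 x ⊆ Q1 x) (h2 : ∀ x, P2 x ⊆ Q2 x) (h3 : ∀ x, P3 x ⊆ Q3 x) :
    NT T P1 P2 P3 ≤ NT T Q1 Q2 Q3 := by
  classical
  unfold NT
  apply Finset.card_le_card
  intro p hp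
  rw [Finset.mem_filter] at hp ⊢
  obtain ⟨-, ht, i, hi, j, hj, k, hk, hrb⟩ := hp
  exact ⟨Finset.mem_univ _, ht, i, h1 _ hi, j, h2 _ hj, k, h3 _ hk, hrb⟩

theorem res_supp {r : ℕ} {V : Type} [Fintype V] [DecidableEq V] (c : V → Fin r) (S : Finset V) :
    (Finset.univ.filter (fun x => res c S x ≠ none)).card ≤ S.card := by
  apply Finset.card_le_card
  intro x hx
  by_contra h
  simp [res, h] at hx

set_option maxHeartbeats 1000000 in
theorem container (r : ℕ) (δ γ : ℝ) (hδ : 0 < δ) (hγ : 0 < γ) :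
    ∃ n₀ : ℕ, ∀ n : ℕ, n₀ ≤ n → ∀ (V : Type) [Fintype V] [DecidableEq V] (T : V → V → V → Prop), Codeg T →
      Fintype.card V ≤ n → ∃ P : Finset (V → Finset (Fin r)), (P.card : ℝ) ≤ (2 : ℝ) ^ (γ * n) ∧
        (∀ Q ∈ P, (NT T Q Q Q : ℝ) ≤ δ * n ^ 2) ∧
        ∀ c : V → Fin r, (∀ x y z, T x y z → ¬ Rb (c x) (c y) (c z)) → ∃ Q ∈ P, ∀ x, c x ∈ Q x := by
  classical
  obtain ⟨ε, hε, hcode⟩ := code_count r (γ / 5) (by positivity)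
  obtain ⟨δ3, θ, hδ3, hθ, h3⟩ := round3 r δ ε hδ hε
  obtain ⟨δ2, hδ2, n2, h2⟩ := round2 r δ3 ε hδ3 hε
  obtain ⟨n1, h1⟩ := round1 r δ2 ε hδ2 hε
  refine ⟨n1 + n2 + 1, ?_⟩
  intro n hn V _ _ T hT hV
  let C : Finset (V → Option (Fin r)) := Finset.univ.filter (fun u =>
    ((Finset.univ.filter (fun x => u x ≠ none)).card : ℝ) ≤ ε * n)
  have hC : (C.card : ℝ) ≤ (2 : ℝ) ^ (γ / 5 * n) := hcode V n hV
  let Φ : (V → Option (Fin r)) × (V → Option (Fin r)) × (V → Option (Fin r)) × (V → Option (Fin r)) ×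
    (V → Option (Fin r)) → V → Finset (Fin r) := fun p x =>
      F1 T p.1 p.2.1 x ∩ (F2 T (F1 T p.1 p.2.1) p.2.2.1 p.2.2.2.1 x ∩
        F3 T (F1 T p.1 p.2.1) (F2 T (F1 T p.1 p.2.1) p.2.2.1 p.2.2.2.1) (θ * n) p.2.2.2.2 x)
  refine ⟨((C ×ˢ C ×ˢ C ×ˢ C ×ˢ C).image Φ).filter (fun Q => (NT T Q Q Q : ℝ) ≤ δ * n ^ 2), ?_, ?_, ?_⟩
  · have e1 : (((C ×ˢ C ×ˢ C ×ˢ C ×ˢ C).image Φ).filter (fun Q => (NT T Q Q Q : ℝ) ≤ δ * n ^ 2)).card ≤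
        C.card ^ 5 := by
      refine (Finset.card_filter_le _ _).trans (Finset.card_image_le.trans ?_)
      simp only [Finset.card_product]
      apply le_of_eq; ring
    have e2 : ((C.card : ℝ)) ^ 5 ≤ ((2 : ℝ) ^ (γ / 5 * n)) ^ 5 := by gcongr
    have e3 : ((2 : ℝ) ^ (γ / 5 * n)) ^ 5 = (2 : ℝ) ^ (γ * n) := by
      rw [← Real.rpow_natCast, ← Real.rpow_mul (by norm_num)]
      congr 1; push_cast; ring
    calc _ ≤ ((C.card ^ 5 : ℕ) : ℝ) := by exact_mod_cast e1
      _ ≤ _ := by push_cast; linarith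
  · intro Q hQ
    exact (Finset.mem_filter.1 hQ).2
  · intro c hc
    obtain ⟨S1, W1, hS1, hW1, hm1, hN1⟩ := h1 n (by omega) V T hT hV c hc
    obtain ⟨S2, W2, hS2, hW2, hm2, hN2⟩ := h2 n (by omega) V T hT hV c _ hN1
    obtain ⟨W3, hW3, hm3, hN3⟩ := h3 n (by omega) V T hT hV c _ _ hN2
    have hmem : ∀ S : Finset V, (S.card : ℝ) ≤ ε * n → res c S ∈ C := by
      intro S hS
      refine Finset.mem_filter.2 ⟨Finset.mem_univ _, le_trans ?_ hS⟩
      exact_mod_cast res_supp c S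
    refine ⟨Φ (res c S1, res c W1, res c S2, res c W2, res c W3), Finset.mem_filter.2 ⟨?_, ?_⟩, ?_⟩
    · refine Finset.mem_image_of_mem _ ?_
      simp only [Finset.mem_product]
      exact ⟨hmem _ hS1, hmem _ hW1, hmem _ hS2, hmem _ hW2, hmem _ hW3⟩
    · refine le_trans ?_ hN3
      exact_mod_cast NT_mono T _ _ _ _ _ _ (fun x => Finset.inter_subset_left)
        (fun x => Finset.inter_subset_right.trans Finset.inter_subset_left)
        (fun x => Finset.inter_subset_right.trans Finset.inter_subset_right)
    · intro x
      exact Finset.mem_inter.2 ⟨hm1 x, Finset.mem_inter.2 ⟨hm2 x, hm3 x⟩⟩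

/-- the 3-AP relation, symmetrized -/
def APR (x y z : ℕ) : Prop :=
  x ≠ y ∧ y ≠ z ∧ x ≠ z ∧ (x + y = 2 * z ∨ x + z = 2 * y ∨ y + z = 2 * x)

/-- a template with few rainbow 3-APs, cleaned up -/
structure Clean {r : ℕ} (n b : ℕ) (A B : Finset ℕ) (P : ℕ → Finset (Fin r)) (R : ℕ → Finset ℕ) : Prop where
  hA : A ⊆ Finset.Icc 1 n
  hB : B ⊆ A
  hAB : (A \ B).card ≤ b
  hR : ∀ z ∈ B, (R z).card ≤ b
  hne : ∀ x ∈ A, (P x).Nonempty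
  hg : ∀ x ∈ A, ∀ y ∈ A, ∀ z ∈ B, APR x y z → y ∉ R z → ∀ i ∈ P x, ∀ j ∈ P y, ∀ k ∈ P z, ¬ Rb i j k

theorem rb123 {r : ℕ} (P Q S : Finset (Fin r)) (h1 : P.Nonempty) (h2 : 2 ≤ Q.card) (h3 : 3 ≤ S.card) :
    ∃ i ∈ P, ∃ j ∈ Q, ∃ k ∈ S, i ≠ j ∧ j ≠ k ∧ i ≠ k := by
  obtain ⟨i, hi⟩ := h1
  have h4 : (Q.erase i).Nonempty := by
    rw [← Finset.card_pos]
    have := Finset.pred_card_le_card_erase (s := Q) (a := i)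
    omega
  obtain ⟨j, hj⟩ := h4
  have h5 : ((S.erase i).erase j).Nonempty := by
    rw [← Finset.card_pos]
    have := Finset.pred_card_le_card_erase (s := S) (a := i)
    have := Finset.pred_card_le_card_erase (s := S.erase i) (a := j)
    omega
  obtain ⟨k, hk⟩ := h5
  simp only [Finset.mem_erase] at hj hk
  exact ⟨i, hi, j, hj.2, k, hk.2.2, fun h => hj.1 h.symm, fun h => hk.1 h.symm, fun h => hk.2.1 h.symm⟩

theorem rb222 {r : ℕ} (P Q S : Finset (Fin r)) (h1 : P.card = 2) (h2 : Q.card = 2) (h3 : S.card = 2)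
    (h : ∀ i ∈ P, ∀ j ∈ Q, ∀ k ∈ S, ¬ (i ≠ j ∧ j ≠ k ∧ i ≠ k)) : P = Q := by
  by_contra hne
  have h4 : ¬ P ⊆ Q := fun hs => hne (Finset.eq_of_subset_of_card_le hs (by omega))
  obtain ⟨i, hi, hiQ⟩ := Finset.not_subset.1 h4
  obtain ⟨a, b, hab, hQ⟩ := Finset.card_eq_two.1 h2
  have hS : S ⊆ {i} := by
    intro k hk
    rw [Finset.mem_singleton]
    have ha := h i hi a (by simp [hQ]) k hk
    have hb := h i hi b (by simp [hQ]) k hk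
    simp only [hQ, Finset.mem_insert, Finset.mem_singleton, not_or] at hiQ
    by_contra hki
    apply hab
    have e1 : a = k := by
      by_contra hh; exact ha ⟨hiQ.1, hh, fun h => hki h.symm⟩
    have e2 : b = k := by
      by_contra hh; exact hb ⟨hiQ.2, hh, fun h => hki h.symm⟩
    rw [e1, e2]
  have := Finset.card_le_card hS
  simp at this
  omega

/-- vertices with at least three colors -/
def X3 {r : ℕ} (B : Finset ℕ) (P : ℕ → Finset (Fin r)) : Finset ℕ := B.filter (fun x => 3 ≤ (P x).card)
/-- vertices with exactly two colors -/
def X2 {r : ℕ} (B : Finset ℕ) (P : ℕ → Finset (Fin r)) : Finset ℕ := B.filter (fun x => (P x).card = 2)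

theorem card_mod_le (n t : ℕ) : ((Finset.Icc 1 n).filter (fun y => ¬ y % 2 = t % 2)).card ≤ (n + 1) / 2 := by
  have : ((Finset.Icc 1 n).filter (fun y => ¬ y % 2 = t % 2)) ⊆
      (Finset.range ((n + 1) / 2)).image (fun u => 2 * u + 1 + t % 2) := by
    intro y hy
    simp only [Finset.mem_filter, Finset.mem_Icc, Finset.mem_image, Finset.mem_range] at hy ⊢
    refine ⟨(y - 1) / 2, ?_, ?_⟩ <;> omega
  refine (Finset.card_le_card this).trans (Finset.card_image_le.trans ?_)
  simp

theorem X23_bound {r n b : ℕ} {A B : Finset ℕ} {P : ℕ → Finset (Fin r)} {R : ℕ → Finset ℕ}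
    (h : Clean n b A B P R) (h3 : (X3 B P).Nonempty) :
    (X2 B P).card + (X3 B P).card ≤ (n + 1) / 2 + 1 + (n - A.card) + b := by
  obtain ⟨x0, hx0⟩ := h3
  obtain ⟨hx0B, hx03⟩ := Finset.mem_filter.1 hx0
  have hd : Disjoint (X2 B P) (X3 B P) := by
    rw [Finset.disjoint_left]
    intro x hx hx'
    have := (Finset.mem_filter.1 hx).2
    have := (Finset.mem_filter.1 hx').2
    omega
  rw [← Finset.card_union_of_disjoint hd]
  have hsub : X2 B P ∪ X3 B P ⊆ (((Finset.Icc 1 n).filter (fun y => ¬ y % 2 = x0 % 2)) ∪ {x0}) ∪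
      ((Finset.Icc 1 n \ A).image (fun m => 2 * m - x0)) ∪ R x0 := by
    intro y hy
    have hy' : y ∈ B ∧ 2 ≤ (P y).card := by
      rcases Finset.mem_union.1 hy with h | h
      · exact ⟨(Finset.mem_filter.1 h).1, by have := (Finset.mem_filter.1 h).2; omega⟩
      · exact ⟨(Finset.mem_filter.1 h).1, by have := (Finset.mem_filter.1 h).2; omega⟩
    obtain ⟨hyB, hyc⟩ := hy'
    have hyI := Finset.mem_Icc.1 (h.hA (h.hB hyB))
    have hxI := Finset.mem_Icc.1 (h.hA (h.hB hx0B))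
    by_contra hcon
    simp only [Finset.mem_union, not_or, Finset.mem_singleton, Finset.mem_filter, not_and, Finset.mem_Icc,
      not_not, Finset.mem_image, Finset.mem_sdiff, not_exists] at hcon
    obtain ⟨⟨⟨hpar, hne⟩, hm⟩, hR⟩ := hcon
    have hpar := hpar hyI
    have hmA : (x0 + y) / 2 ∈ A := by
      by_contra hmA
      exact hm ((x0 + y) / 2) ⟨by omega, hmA⟩ (by omega)
    obtain ⟨i, hi, j, hj, k, hk, hrb⟩ := rb123 (P ((x0 + y) / 2)) (P y) (P x0) (h.hne _ hmA) hyc hx03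
    exact h.hg _ hmA y (h.hB hyB) x0 hx0B ⟨by omega, by omega, by omega, by omega⟩ hR i hi j hj k hk hrb
  refine (Finset.card_le_card hsub).trans ?_
  have e1 := Finset.card_union_le ((((Finset.Icc 1 n).filter (fun y => ¬ y % 2 = x0 % 2)) ∪ {x0}) ∪
      ((Finset.Icc 1 n \ A).image (fun m => 2 * m - x0))) (R x0)
  have e2 := Finset.card_union_le (((Finset.Icc 1 n).filter (fun y => ¬ y % 2 = x0 % 2)) ∪ {x0})
      ((Finset.Icc 1 n \ A).image (fun m => 2 * m - x0))
  have e3 := Finset.card_union_le ((Finset.Icc 1 n).filter (fun y => ¬ y % 2 = x0 % 2)) {x0}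
  have e4 := card_mod_le n x0
  have e5 := h.hR x0 hx0B
  have e6 : ((Finset.Icc 1 n \ A).image (fun m => 2 * m - x0)).card ≤ n - A.card := by
    refine Finset.card_image_le.trans ?_
    rw [Finset.card_sdiff_of_subset h.hA]; simp
  simp only [Finset.card_singleton] at e3
  omega

theorem X3_parity {r n b : ℕ} {A B : Finset ℕ} {P : ℕ → Finset (Fin r)} {R : ℕ → Finset ℕ}
    (h : Clean n b A B P R) (t : ℕ) :
    2 * ((X3 B P).filter (fun x => x % 2 = t)).card ≤ (n - A.card) + 4 + 2 * b := by
  set E := (X3 B P).filter (fun x => x % 2 = t) with hE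
  rcases E.eq_empty_or_nonempty with h0 | hne
  · rw [h0]; simp
  have hEm : ∀ x ∈ E, x ∈ B ∧ 3 ≤ (P x).card ∧ x % 2 = t ∧ 1 ≤ x ∧ x ≤ n := by
    intro x hx
    obtain ⟨h1, h2⟩ := Finset.mem_filter.1 hx
    obtain ⟨h3, h4⟩ := Finset.mem_filter.1 h1
    have := Finset.mem_Icc.1 (h.hA (h.hB h3))
    exact ⟨h3, h4, h2, this⟩
  have key : ∀ x ∈ E, ∀ y ∈ E, x ≠ y → y ∉ R x → (x + y) / 2 ∉ A := by
    intro x hx y hy hxy hR hmA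
    obtain ⟨hx1, hx2, hx3, hx4⟩ := hEm x hx
    obtain ⟨hy1, hy2, hy3, hy4⟩ := hEm y hy
    obtain ⟨i, hi, j, hj, k, hk, hrb⟩ := rb123 (P ((x + y) / 2)) (P y) (P x) (h.hne _ hmA) (by omega) hx2
    exact h.hg _ hmA y (h.hB hy1) x hx1 ⟨by omega, by omega, by omega, by omega⟩ hR i hi j hj k hk hrb
  set x1 := E.min' hne
  set x2 := E.max' hne
  have hx1 : x1 ∈ E := E.min'_mem hne
  have hx2 : x2 ∈ E := E.max'_mem hne
  let E' := (E.erase x1).erase x2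
  have hE' : E.card ≤ E'.card + 2 := by
    have := Finset.pred_card_le_card_erase (s := E) (a := x1)
    have := Finset.pred_card_le_card_erase (s := E.erase x1) (a := x2)
    show E.card ≤ ((E.erase x1).erase x2).card + 2
    omega
  have hE'm : ∀ y ∈ E', y ∈ E ∧ x1 < y ∧ y < x2 := by
    intro y hy
    simp only [E', Finset.mem_erase] at hy
    have h1 : x1 ≤ y := E.min'_le y hy.2.2
    have h2 : y ≤ x2 := E.le_max' y hy.2.2
    exact ⟨hy.2.2, by omega, by omega⟩
  let M1 := (E' \ R x1).image (fun y => (x1 + y) / 2)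
  let M2 := (E' \ R x2).image (fun y => (x2 + y) / 2)
  have hc : ∀ x ∈ E, E'.card ≤ ((E' \ R x).image (fun y => (x + y) / 2)).card + b := by
    intro x hx
    rw [Finset.card_image_of_injOn]
    · have h1 := h.hR x (hEm x hx).1
      have h2 := Finset.le_card_sdiff (R x) E'
      omega
    · intro y hy y' hy' hyy
      have h1 := hEm y (hE'm y (Finset.mem_sdiff.1 hy).1).1
      have h2 := hEm y' (hE'm y' (Finset.mem_sdiff.1 hy').1).1
      have h3 := hEm x hx
      simp only at hyy
      omega
  have hd : Disjoint M1 M2 := by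
    rw [Finset.disjoint_left]
    intro m hm1 hm2
    obtain ⟨y, hy, rfl⟩ := Finset.mem_image.1 hm1
    obtain ⟨y', hy', he⟩ := Finset.mem_image.1 hm2
    have h1 := hE'm y (Finset.mem_sdiff.1 hy).1
    have h2 := hE'm y' (Finset.mem_sdiff.1 hy').1
    have h3 := hEm _ hx1
    have h4 := hEm _ hx2
    have h5 := hEm _ h1.1
    have h6 := hEm _ h2.1
    omega
  have hsub : M1 ∪ M2 ⊆ Finset.Icc 1 n \ A := by
    intro m hm
    rw [Finset.mem_sdiff, Finset.mem_Icc]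
    rcases Finset.mem_union.1 hm with hm | hm
    · obtain ⟨y, hy, rfl⟩ := Finset.mem_image.1 hm
      have h1 := hE'm y (Finset.mem_sdiff.1 hy).1
      have h3 := hEm _ hx1
      have h5 := hEm _ h1.1
      exact ⟨by omega, key x1 hx1 y h1.1 (by omega) (Finset.mem_sdiff.1 hy).2⟩
    · obtain ⟨y, hy, rfl⟩ := Finset.mem_image.1 hm
      have h1 := hE'm y (Finset.mem_sdiff.1 hy).1
      have h3 := hEm _ hx2
      have h5 := hEm _ h1.1
      exact ⟨by omega, key x2 hx2 y h1.1 (by omega) (Finset.mem_sdiff.1 hy).2⟩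
  have e1 := Finset.card_le_card hsub
  rw [Finset.card_union_of_disjoint hd, Finset.card_sdiff_of_subset h.hA] at e1
  have e2 := hc x1 hx1
  have e3 := hc x2 hx2
  change E'.card ≤ M1.card + b at e2
  change E'.card ≤ M2.card + b at e3
  simp only [Nat.card_Icc, Nat.add_sub_cancel] at e1
  omega

theorem X3_bound {r n b : ℕ} {A B : Finset ℕ} {P : ℕ → Finset (Fin r)} {R : ℕ → Finset ℕ}
    (h : Clean n b A B P R) : (X3 B P).card ≤ (n - A.card) + 4 + 2 * b := by
  have h0 := X3_parity h 0
  have h1 := X3_parity h 1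
  have h2 := Finset.card_filter_add_card_filter_not (s := X3 B P) (fun x => x % 2 = 0)
  have h3 : (X3 B P).filter (fun x => ¬ x % 2 = 0) = (X3 B P).filter (fun x => x % 2 = 1) := by
    apply Finset.filter_congr
    intro x _
    omega
  rw [h3] at h2
  omega

theorem pal_near {r n b : ℕ} {A B : Finset ℕ} {P : ℕ → Finset (Fin r)} {R : ℕ → Finset ℕ}
    (h : Clean n b A B P R) (hq : 100 * (Finset.Icc 1 n \ X2 B P).card ≤ n) (hb : 100 * b + 1000 ≤ n)
    (x y : ℕ) (hx : x ∈ X2 B P) (hy : y ∈ X2 B P) (hxy : x < y) (hn : 8 * (y - x) ≤ n) : P x = P y := by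
  have hX : ∀ x ∈ X2 B P, x ∈ B ∧ (P x).card = 2 ∧ 1 ≤ x ∧ x ≤ n := by
    intro x hx
    obtain ⟨h3, h4⟩ := Finset.mem_filter.1 hx
    have := Finset.mem_Icc.1 (h.hA (h.hB h3))
    exact ⟨h3, h4, this⟩
  have hx' := hX x hx
  have hy' := hX y hy
  have key : ∀ u ∈ X2 B P, ∀ m ∈ X2 B P, m ≠ u → u ≤ 2 * m → 2 * m - u ∈ X2 B P → m ∉ R u → P m = P u := by
    intro u hu m hm hne hle hw hR
    have hu' := hX u hu
    have hm' := hX m hm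
    have hw' := hX _ hw
    apply rb222 (P m) (P u) (P (2 * m - u)) hm'.2.1 hu'.2.1 hw'.2.1
    rintro i hi j hj k hk ⟨h1, h2, h3⟩
    exact h.hg (2 * m - u) (h.hB hw'.1) m (h.hB hm'.1) u hu'.1 ⟨by omega, by omega, by omega, by omega⟩ hR
      k hk i hi j hj ⟨fun h => h3 h.symm, h1, fun h => h2 h.symm⟩
  set Mi := Finset.Icc 1 n \ X2 B P with hMi
  have hin : ∀ w, 1 ≤ w → w ≤ n → w ∉ Mi → w ∈ X2 B P := by
    intro w h1 h2 h3
    by_contra h4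
    exact h3 (Finset.mem_sdiff.2 ⟨Finset.mem_Icc.2 ⟨h1, h2⟩, h4⟩)
  have main : ∀ I : Finset ℕ, n ≤ 8 * I.card + 8 → (∀ m ∈ I, (m < x ∨ y < m) ∧ 1 ≤ m ∧ m ≤ n ∧
      y + 1 ≤ 2 * m ∧ 2 * m ≤ n + x) → P x = P y := by
    intro I hI hIm
    let bad := Mi ∪ Mi.image (fun w => (w + x) / 2) ∪ Mi.image (fun w => (w + y) / 2) ∪ R x ∪ R y
    have hbad : bad.card ≤ 3 * Mi.card + 2 * b := by
      have e1 := Finset.card_union_le (Mi ∪ Mi.image (fun w => (w + x) / 2) ∪ Mi.image (fun w => (w + y) / 2) ∪ R x) (R y)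
      have e2 := Finset.card_union_le (Mi ∪ Mi.image (fun w => (w + x) / 2) ∪ Mi.image (fun w => (w + y) / 2)) (R x)
      have e3 := Finset.card_union_le (Mi ∪ Mi.image (fun w => (w + x) / 2)) (Mi.image (fun w => (w + y) / 2))
      have e4 := Finset.card_union_le Mi (Mi.image (fun w => (w + x) / 2))
      have e5 : (Mi.image (fun w => (w + x) / 2)).card ≤ Mi.card := Finset.card_image_le
      have e6 : (Mi.image (fun w => (w + y) / 2)).card ≤ Mi.card := Finset.card_image_le
      have e7 := h.hR x hx'.1
      have e8 := h.hR y hy'.1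
      show (Mi ∪ Mi.image (fun w => (w + x) / 2) ∪ Mi.image (fun w => (w + y) / 2) ∪ R x ∪ R y).card ≤ _
      omega
    have hlt : bad.card < I.card := by omega
    obtain ⟨m, hmI, hmb⟩ := Finset.exists_mem_notMem_of_card_lt_card hlt
    simp only [bad, Finset.mem_union, not_or, Finset.mem_image, not_exists, not_and] at hmb
    obtain ⟨⟨⟨⟨hb1, hb2⟩, hb3⟩, hb4⟩, hb5⟩ := hmb
    have hm' := hIm m hmI
    have hmX := hin m hm'.2.1 hm'.2.2.1 hb1
    have h1 : 2 * m - x ∈ X2 B P := hin _ (by omega) (by omega) (fun hh => hb2 _ hh (by omega))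
    have h2 : 2 * m - y ∈ X2 B P := hin _ (by omega) (by omega) (fun hh => hb3 _ hh (by omega))
    rw [← key x hx m hmX (by omega) (by omega) h1 hb4, ← key y hy m hmX (by omega) (by omega) h2 hb5]
  by_cases hyn : 2 * y ≤ n
  · apply main (Finset.Ioc y (y + n / 8))
    · simp; omega
    · intro m hm
      rw [Finset.mem_Ioc] at hm
      omega
  · apply main (Finset.Ico (x - n / 8) x)
    · simp; omega
    · intro m hm
      rw [Finset.mem_Ico] at hm
      omega

theorem pal_all {r n b : ℕ} {A B : Finset ℕ} {P : ℕ → Finset (Fin r)} {R : ℕ → Finset ℕ}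
    (h : Clean n b A B P R) (hq : 100 * (Finset.Icc 1 n \ X2 B P).card ≤ n) (hb : 100 * b + 1000 ≤ n) :
    ∀ d x y : ℕ, y - x ≤ d → x ∈ X2 B P → y ∈ X2 B P → x < y → P x = P y := by
  intro d
  induction d with
  | zero => intro x y h1 _ _ h2; omega
  | succ d ih =>
    intro x y hd hx hy hxy
    by_cases hs : 8 * (y - x) ≤ n
    · exact pal_near h hq hb x y hx hy hxy hs
    · have hlt : (Finset.Icc 1 n \ X2 B P).card < (Finset.Ioo x y).card := by
        simp only [Nat.card_Ioo]; omega
      obtain ⟨m, hm, hmb⟩ := Finset.exists_mem_notMem_of_card_lt_card hlt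
      rw [Finset.mem_Ioo] at hm
      have hyI := Finset.mem_Icc.1 (h.hA (h.hB (Finset.mem_filter.1 hy).1))
      have hmX : m ∈ X2 B P := by
        by_contra h4
        exact hmb (Finset.mem_sdiff.2 ⟨Finset.mem_Icc.2 ⟨by omega, by omega⟩, h4⟩)
      rw [ih x m (by omega) hx hmX hm.1, ih m y (by omega) hmX hy hm.2]

theorem rf_mid {r : ℕ} {A : Finset ℕ} {c : A → Fin r} (hc : RainbowAPFree A c) (x m y : A)
    (h1 : x.1 < m.1) (h2 : x.1 + y.1 = 2 * m.1) : c x = c m ∨ c m = c y ∨ c x = c y := by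
  obtain ⟨x, hx⟩ := x
  obtain ⟨m, hm⟩ := m
  obtain ⟨y, hy⟩ := y
  simp only at h1 h2
  obtain ⟨d, rfl⟩ := Nat.exists_eq_add_of_lt h1
  obtain rfl : y = x + 2 * (d + 1) := by omega
  exact hc x (d + 1) (by omega) hx hm hy

theorem rf_apr {r : ℕ} {A : Finset ℕ} {c : A → Fin r} (hc : RainbowAPFree A c) (x y z : A)
    (h : APR x.1 y.1 z.1) : ¬ Rb (c x) (c y) (c z) := by
  rintro ⟨h1, h2, h3⟩
  obtain ⟨g1, g2, g3, h | h | h⟩ := h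
  · rcases lt_or_ge x.1 z.1 with hh | hh
    · rcases rf_mid hc x z y hh h with h | h | h <;> simp_all
    · rcases rf_mid hc y z x (by omega) (by omega) with h | h | h <;> simp_all
  · rcases lt_or_ge x.1 y.1 with hh | hh
    · rcases rf_mid hc x y z hh h with h | h | h <;> simp_all
    · rcases rf_mid hc z y x (by omega) (by omega) with h | h | h <;> simp_all
  · rcases lt_or_ge y.1 x.1 with hh | hh
    · rcases rf_mid hc y x z hh h with h | h | h <;> simp_all
    · rcases rf_mid hc z x y (by omega) (by omega) with h | h | h <;> simp_all

open Classical in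
/-- rainbow-free colorings inside a template that are not two-colorings -/
noncomputable def KP {r : ℕ} (A : Finset ℕ) (P : ℕ → Finset (Fin r)) : Finset (A → Fin r) :=
  Finset.univ.filter (fun c => RainbowAPFree A c ∧ (∀ x : A, c x ∈ P x) ∧
    ¬ ∃ Q : Finset (Fin r), Q.card = 2 ∧ ∀ x, c x ∈ Q)

theorem prod_bound {r : ℕ} (hr : 1 ≤ r) (A U W : Finset ℕ) (P : ℕ → Finset (Fin r))
    (h1 : ∀ x ∈ A, x ∉ U → (P x).card ≤ 2) (h2 : ∀ x ∈ A, x ∉ U → x ∉ W → (P x).card ≤ 1) :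
    (Fintype.piFinset (fun x : A => P x)).card ≤ r ^ U.card * 2 ^ W.card := by
  rw [Fintype.card_piFinset, Finset.prod_coe_sort A (fun x => (P x).card)]
  calc ∏ x ∈ A, (P x).card ≤ ∏ x ∈ A, ((if x ∈ U then r else 1) * (if x ∈ W then 2 else 1)) := by
        apply Finset.prod_le_prod'
        intro x hx
        have hc : (P x).card ≤ r := by simpa using Finset.card_le_univ (P x)
        by_cases hU : x ∈ U
        · by_cases hW : x ∈ W
          · simp only [hU, hW, if_true]; omega
          · simp only [hU, hW, if_true, if_false]; omega
        · by_cases hW : x ∈ W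
          · simp only [hU, hW, if_true, if_false, one_mul]; exact h1 x hx hU
          · simp only [hU, hW, if_false, one_mul]; exact h2 x hx hU hW
    _ = r ^ (A.filter (fun x => x ∈ U)).card * 2 ^ (A.filter (fun x => x ∈ W)).card := by
        rw [Finset.prod_mul_distrib, Finset.prod_ite, Finset.prod_ite]
        simp
    _ ≤ _ := by
        apply Nat.mul_le_mul
        · apply Nat.pow_le_pow_right hr
          apply Finset.card_le_card
          intro x hx; exact (Finset.mem_filter.1 hx).2
        · apply Nat.pow_le_pow_right (by norm_num)
          apply Finset.card_le_card
          intro x hx; exact (Finset.mem_filter.1 hx).2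

theorem KP_simple {r n b : ℕ} (hr : 1 ≤ r) {A B : Finset ℕ} {P : ℕ → Finset (Fin r)} {R : ℕ → Finset ℕ}
    (h : Clean n b A B P R) : (KP A P).card ≤ r ^ (b + (X3 B P).card) * 2 ^ (X2 B P).card := by
  classical
  have h1 : (KP A P).card ≤ (Fintype.piFinset (fun x : A => P x)).card := by
    apply Finset.card_le_card
    intro c hc
    rw [Fintype.mem_piFinset]
    exact (Finset.mem_filter.1 hc).2.2.1
  refine h1.trans ((prod_bound hr A (A \ B ∪ X3 B P) (X2 B P) P ?_ ?_).trans ?_)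
  · intro x hx hU
    by_contra hcon
    apply hU
    by_cases hxB : x ∈ B
    · exact Finset.mem_union_right _ (Finset.mem_filter.2 ⟨hxB, by omega⟩)
    · exact Finset.mem_union_left _ (Finset.mem_sdiff.2 ⟨hx, hxB⟩)
  · intro x hx hU hW
    by_contra hcon
    by_cases hxB : x ∈ B
    · by_cases h2 : (P x).card = 2
      · exact hW (Finset.mem_filter.2 ⟨hxB, h2⟩)
      · exact hU (Finset.mem_union_right _ (Finset.mem_filter.2 ⟨hxB, by omega⟩))
    · exact hU (Finset.mem_union_left _ (Finset.mem_sdiff.2 ⟨hx, hxB⟩))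
  · apply Nat.mul_le_mul_right
    apply Nat.pow_le_pow_right hr
    exact (Finset.card_union_le _ _).trans (Nat.add_le_add_right h.hAB _)

set_option maxHeartbeats 1000000 in
theorem KP_one {r n b : ℕ} (hr : 1 ≤ r) {A B : Finset ℕ} {P : ℕ → Finset (Fin r)} {R : ℕ → Finset ℕ}
    (h : Clean n b A B P R) (h3 : X3 B P = ∅) (hq : 100 * (Finset.Icc 1 n \ X2 B P).card ≤ n)
    (hb : 100 * b + 1000 ≤ n) (Q : Finset (Fin r)) (hQ : ∀ x ∈ X2 B P, P x = Q) (x : A) :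
    ((KP A P).filter (fun c => c x ∉ Q)).card ≤ r ^ b * 2 ^ (9 * n / 10) := by
  classical
  have hxI := Finset.mem_Icc.1 (h.hA x.2)
  have hXA : ∀ y ∈ X2 B P, y ∈ A := fun y hy => h.hB (Finset.mem_filter.1 hy).1
  obtain ⟨s, hs1, hs2, hs3⟩ : ∃ s : ℕ → ℕ, (∀ e, 1 ≤ e → 2 * e ≤ n → 1 ≤ s e ∧ s e ≤ n) ∧
      (∀ e f, 1 ≤ e → 2 * e ≤ n → 1 ≤ f → 2 * f ≤ n → s e = s f → e = f) ∧
      (∀ d, 1 ≤ d → 4 * d ≤ n → APR x.1 (s d) (s (2 * d))) := by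
    by_cases hx : 2 * x.1 ≤ n
    · refine ⟨fun e => x.1 + e, ?_, ?_, ?_⟩
      · intro e h1 h2; simp only; omega
      · intro e f h1 h2 h3 h4 h5; simp only at h5; omega
      · intro d h1 h2; refine ⟨?_, ?_, ?_, ?_⟩ <;> simp only <;> omega
    · refine ⟨fun e => x.1 - e, ?_, ?_, ?_⟩
      · intro e h1 h2; simp only; omega
      · intro e f h1 h2 h3 h4 h5; simp only at h5; omega
      · intro d h1 h2; refine ⟨?_, ?_, ?_, ?_⟩ <;> simp only <;> omega
  set Mi := Finset.Icc 1 n \ X2 B P with hMi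
  let D0 := Finset.Ioc (n / 8) (n / 4)
  let G := D0.filter (fun d => s d ∈ X2 B P ∧ s (2 * d) ∈ X2 B P)
  let Y := G.image (fun d => s (2 * d))
  have hD0 : ∀ d ∈ D0, n / 8 + 1 ≤ d ∧ d ≤ n / 4 := by
    intro d hd
    have := Finset.mem_Ioc.1 hd
    omega
  have hGD : ∀ d ∈ G, n / 8 + 1 ≤ d ∧ d ≤ n / 4 := fun d hd => hD0 d (Finset.mem_filter.1 hd).1
  have hYc : Y.card = G.card := by
    apply Finset.card_image_of_injOn
    intro d hd e he hde
    have := hGD d hd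
    have := hGD e he
    have := hs2 (2 * d) (2 * e) (by omega) (by omega) (by omega) (by omega) hde
    omega
  have hGc : n ≤ 10 * G.card := by
    have e1 : D0 ⊆ G ∪ (D0.filter (fun d => s d ∈ Mi) ∪ D0.filter (fun d => s (2 * d) ∈ Mi)) := by
      intro d hd
      have hd' := hD0 d hd
      by_contra hcon
      simp only [Finset.mem_union, Finset.mem_filter, not_or, not_and, G, hd, true_imp_iff, hMi,
        Finset.mem_sdiff, Finset.mem_Icc, not_not] at hcon
      obtain ⟨g1, g2, g3⟩ := hcon
      exact g1 (g2 (hs1 d (by omega) (by omega))) (g3 (hs1 (2 * d) (by omega) (by omega)))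
    have e2 := (Finset.card_le_card e1).trans (Finset.card_union_le _ _)
    have e3 := Finset.card_union_le (D0.filter (fun d => s d ∈ Mi)) (D0.filter (fun d => s (2 * d) ∈ Mi))
    have e4 : (D0.filter (fun d => s d ∈ Mi)).card ≤ Mi.card := by
      apply Finset.card_le_card_of_injOn s
      · intro d hd; exact (Finset.mem_filter.1 hd).2
      · intro d hd e he hde
        have := hD0 d (Finset.mem_filter.1 hd).1
        have := hD0 e (Finset.mem_filter.1 he).1
        exact hs2 d e (by omega) (by omega) (by omega) (by omega) hde
    have e5 : (D0.filter (fun d => s (2 * d) ∈ Mi)).card ≤ Mi.card := by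
      apply Finset.card_le_card_of_injOn (fun d => s (2 * d))
      · intro d hd; exact (Finset.mem_filter.1 hd).2
      · intro d hd e he hde
        have := hD0 d (Finset.mem_filter.1 hd).1
        have := hD0 e (Finset.mem_filter.1 he).1
        have := hs2 (2 * d) (2 * e) (by omega) (by omega) (by omega) (by omega) hde
        omega
    have e6 : D0.card = n / 4 - n / 8 := by simp [D0]
    omega
  have i0 : Fin r := ⟨0, hr⟩
  let P' : ℕ → Finset (Fin r) := fun y => if y ∈ Y then {i0} else P y
  have hdn : ∀ d ∈ G, s d ∉ Y := by
    intro d hd hY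
    obtain ⟨e, he, hde⟩ := Finset.mem_image.1 hY
    have h1 := hGD d hd
    have h2 := hGD e he
    have := hs2 (2 * e) d (by omega) (by omega) (by omega) (by omega) hde
    omega
  have hinj : ((KP A P).filter (fun c => c x ∉ Q)).card ≤ (Fintype.piFinset (fun y : A => P' y)).card := by
    apply Finset.card_le_card_of_injOn (fun c (y : A) => if y.1 ∈ Y then i0 else c y)
    · intro c hc
      have hc := (Finset.mem_filter.1 (Finset.mem_filter.1 hc).1).2.2.1
      simp only [Finset.mem_coe, Fintype.mem_piFinset, P']
      intro y
      by_cases hy : y.1 ∈ Y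
      · simp [hy]
      · simp only [hy, if_false]; exact hc y
    · have hmono : ∀ c ∈ (KP A P).filter (fun c => c x ∉ Q), ∀ d ∈ G, ∀ (g1 : s d ∈ A) (g2 : s (2 * d) ∈ A),
          c ⟨s d, g1⟩ = c ⟨s (2 * d), g2⟩ := by
        intro c hc d hd g1 g2
        obtain ⟨hcK, hcx⟩ := Finset.mem_filter.1 hc
        obtain ⟨-, hrf, hcP, -⟩ := Finset.mem_filter.1 hcK
        obtain ⟨-, hd1, hd2⟩ := Finset.mem_filter.1 hd
        have hdd := hGD d hd
        have hap := rf_apr hrf x ⟨s d, g1⟩ ⟨s (2 * d), g2⟩ (hs3 d (by omega) (by omega))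
        have m1 := hcP ⟨s d, g1⟩
        have m2 := hcP ⟨s (2 * d), g2⟩
        rw [hQ _ hd1] at m1
        rw [hQ _ hd2] at m2
        by_contra hne
        apply hap
        refine ⟨?_, hne, ?_⟩
        · intro he; rw [he] at hcx; exact hcx m1
        · intro he; rw [he] at hcx; exact hcx m2
      intro c hc c' hc' he
      have hev : ∀ y : A, y.1 ∉ Y → c y = c' y := by
        intro y hy
        have := congrFun he y
        simpa [hy] using this
      funext y
      by_cases hy : y.1 ∈ Y
      · obtain ⟨d, hd, hdy⟩ := Finset.mem_image.1 hy
        obtain ⟨-, hd1, hd2⟩ := Finset.mem_filter.1 hd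
        have e1 := hmono c hc d hd (hXA _ hd1) (hXA _ hd2)
        have e2 := hmono c' hc' d hd (hXA _ hd1) (hXA _ hd2)
        have e3 := hev ⟨s d, hXA _ hd1⟩ (hdn d hd)
        have e4 : y = ⟨s (2 * d), hXA _ hd2⟩ := Subtype.ext hdy.symm
        rw [e4, ← e1, ← e2, e3]
      · exact hev y hy
  refine hinj.trans ((prod_bound hr A (A \ B) (X2 B P \ Y) P' ?_ ?_).trans ?_)
  · intro y hy hU
    have hyB : y ∈ B := by
      by_contra hh; exact hU (Finset.mem_sdiff.2 ⟨hy, hh⟩)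
    by_cases hyY : y ∈ Y
    · simp [P', hyY]
    · simp only [P', hyY, if_false]
      by_contra hcon
      have : y ∈ X3 B P := Finset.mem_filter.2 ⟨hyB, by omega⟩
      simp [h3] at this
  · intro y hy hU hW
    have hyB : y ∈ B := by
      by_contra hh; exact hU (Finset.mem_sdiff.2 ⟨hy, hh⟩)
    by_cases hyY : y ∈ Y
    · simp [P', hyY]
    · simp only [P', hyY, if_false]
      by_contra hcon
      by_cases h2 : (P y).card = 2
      · exact hW (Finset.mem_sdiff.2 ⟨Finset.mem_filter.2 ⟨hyB, h2⟩, hyY⟩)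
      · have : y ∈ X3 B P := Finset.mem_filter.2 ⟨hyB, by omega⟩
        simp [h3] at this
  · apply Nat.mul_le_mul
    · exact Nat.pow_le_pow_right hr h.hAB
    · apply Nat.pow_le_pow_right (by norm_num)
      have hYX : Y ⊆ X2 B P := by
        intro y hy
        obtain ⟨d, hd, rfl⟩ := Finset.mem_image.1 hy
        exact (Finset.mem_filter.1 hd).2.2
      have e1 := Finset.card_sdiff_of_subset hYX
      have e2 : (X2 B P).card ≤ n := by
        have hs : X2 B P ⊆ Finset.Icc 1 n := (Finset.filter_subset _ B).trans (h.hB.trans h.hA)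
        have := Finset.card_le_card hs
        rw [Nat.card_Icc] at this
        omega
      omega

theorem KP_caseI {r n b : ℕ} (hr : 1 ≤ r) {A B : Finset ℕ} {P : ℕ → Finset (Fin r)} {R : ℕ → Finset ℕ}
    (h : Clean n b A B P R) (h3 : X3 B P = ∅) (hq : 100 * (Finset.Icc 1 n \ X2 B P).card ≤ n)
    (hb : 100 * b + 1000 ≤ n) : (KP A P).card ≤ n * (r ^ b * 2 ^ (9 * n / 10)) := by
  classical
  have hne : (X2 B P).Nonempty := by
    by_contra hcon
    rw [Finset.not_nonempty_iff_eq_empty] at hcon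
    rw [hcon] at hq
    simp at hq
    omega
  obtain ⟨x0, hx0⟩ := hne
  have hQ : ∀ x ∈ X2 B P, P x = P x0 := by
    intro x hx
    rcases lt_trichotomy x x0 with hh | hh | hh
    · exact pal_all h hq hb _ x x0 le_rfl hx hx0 hh
    · rw [hh]
    · exact (pal_all h hq hb _ x0 x le_rfl hx0 hx hh).symm
  have hsub : KP A P ⊆ Finset.univ.biUnion (fun x : A => (KP A P).filter (fun c => c x ∉ P x0)) := by
    intro c hc
    obtain ⟨-, -, -, hn⟩ := Finset.mem_filter.1 hc
    rw [Finset.mem_biUnion]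
    by_contra hcon
    apply hn
    refine ⟨P x0, (Finset.mem_filter.1 hx0).2, ?_⟩
    intro x
    by_contra hx
    exact hcon ⟨x, Finset.mem_univ _, Finset.mem_filter.2 ⟨hc, hx⟩⟩
  refine (Finset.card_le_card hsub).trans (Finset.card_biUnion_le.trans ?_)
  refine (Finset.sum_le_card_nsmul _ _ _ (fun x _ => KP_one hr h h3 hq hb (P x0) hQ x)).trans ?_
  rw [smul_eq_mul]
  apply Nat.mul_le_mul_right
  have := Finset.card_le_card h.hA
  simpa using this

theorem nat_le_exp : ∃ n₀ : ℕ, ∀ n : ℕ, n₀ ≤ n → (n : ℝ) ≤ (2 : ℝ) ^ ((1 / 20 : ℝ) * n) := by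
  have h1 : (1 : ℝ) < (2 : ℝ) ^ (1 / 20 : ℝ) := Real.one_lt_rpow (by norm_num) (by norm_num)
  have h2 := tendsto_pow_const_div_const_pow_of_one_lt 1 h1
  have h3 := h2.eventually (gt_mem_nhds (show (0 : ℝ) < 1 by norm_num))
  obtain ⟨n₀, hn⟩ := Filter.eventually_atTop.1 h3
  refine ⟨n₀, fun n h => ?_⟩
  have h4 := hn n h
  rw [div_lt_one (by positivity)] at h4
  rw [Real.rpow_mul (by norm_num), Real.rpow_natCast]
  simpa using h4.le

theorem KP_num (r : ℕ) (hr : 3 ≤ r) (ξ : ℝ) (hξ0 : 0 < ξ) (hξ : ξ ≤ 3 / (5 + 8 * Real.logb 2 r)) :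
    ∃ β : ℝ, 0 < β ∧ ∃ n₀ : ℕ, ∀ n : ℕ, n₀ ≤ n → ∀ b : ℕ, (b : ℝ) ≤ β * n →
      ∀ (A B : Finset ℕ) (P : ℕ → Finset (Fin r)) (R : ℕ → Finset ℕ), Clean n b A B P R →
      (1 - ξ) * n ≤ (A.card : ℝ) → ((KP A P).card : ℝ) ≤ (2 : ℝ) ^ ((199 / 200 : ℝ) * n) := by
  set L := Real.logb 2 r with hL
  have hr0 : (0 : ℝ) < r := by
    have : 0 < r := by omega
    exact_mod_cast this
  have hL1 : 1 ≤ L := by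
    have h2r : (2 : ℝ) ≤ r := by
      have : 2 ≤ r := by omega
      exact_mod_cast this
    rw [hL, Real.le_logb_iff_rpow_le (by norm_num) hr0]
    simpa using h2r
  have hrL : ∀ t : ℕ, ((r : ℝ)) ^ t = (2 : ℝ) ^ (L * t) := by
    intro t
    rw [Real.rpow_mul (by norm_num), hL, Real.rpow_logb (by norm_num) (by norm_num) hr0, Real.rpow_natCast]
  have h2L : ∀ t : ℕ, ((2 : ℝ)) ^ t = (2 : ℝ) ^ (t : ℝ) := fun t => (Real.rpow_natCast _ _).symm
  have hLξ : L * ξ ≤ 3 / 8 := by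
    rw [le_div_iff₀ (by positivity)] at hξ
    nlinarith
  obtain ⟨n1, hn1⟩ := nat_le_exp
  refine ⟨1 / (1000 * L), by positivity, n1 + 2000 + ⌈100 * (4 * L + 2)⌉₊, ?_⟩
  intro n hn b hb A B P R h hA
  have hnL : 100 * (4 * L + 2) ≤ n := by
    refine (Nat.le_ceil _).trans ?_
    have : ⌈100 * (4 * L + 2)⌉₊ ≤ n := by omega
    exact_mod_cast this
  have hn2000 : (2000 : ℝ) ≤ n := by
    have : 2000 ≤ n := by omega
    exact_mod_cast this
  have hLb : L * b ≤ n / 1000 := by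
    have : L * b ≤ L * (1 / (1000 * L) * n) := by gcongr
    have e : L * (1 / (1000 * L) * n) = n / 1000 := by field_simp
    linarith
  have hb1 : (b : ℝ) ≤ n / 1000 := by nlinarith [Nat.cast_nonneg (α := ℝ) b]
  have hbn : 100 * b + 1000 ≤ n := by
    have : (100 * b + 1000 : ℝ) ≤ n := by linarith
    exact_mod_cast this
  have hAn : A.card ≤ n := by
    have := Finset.card_le_card h.hA
    simpa using this
  have hk : ((n - A.card : ℕ) : ℝ) ≤ ξ * n := by
    rw [Nat.cast_sub hAn]; linarith
  have hsimple : ((KP A P).card : ℝ) ≤ (2 : ℝ) ^ (L * (b + (X3 B P).card) + (X2 B P).card) := by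
    have h1 := KP_simple (by omega) h
    have h2 : ((KP A P).card : ℝ) ≤ (r : ℝ) ^ (b + (X3 B P).card) * 2 ^ (X2 B P).card := by exact_mod_cast h1
    rw [hrL, h2L, ← Real.rpow_add (by norm_num)] at h2
    exact_mod_cast h2
  rcases (X3 B P).eq_empty_or_nonempty with h3 | h3
  · by_cases hq : 100 * (Finset.Icc 1 n \ X2 B P).card ≤ n
    · have h1 := KP_caseI (by omega) h h3 hq hbn
      have h2 : ((KP A P).card : ℝ) ≤ n * ((r : ℝ) ^ b * 2 ^ (9 * n / 10)) := by exact_mod_cast h1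
      refine h2.trans ?_
      have h5 : ((9 * n / 10 : ℕ) : ℝ) ≤ 9 / 10 * n := by
        have : ((9 * n / 10 : ℕ) : ℝ) ≤ ((9 * n : ℕ) : ℝ) / ((10 : ℕ) : ℝ) := Nat.cast_div_le
        push_cast at this
        linarith
      rw [hrL, h2L, ← Real.rpow_add (by norm_num)]
      calc (n : ℝ) * (2 : ℝ) ^ (L * b + ((9 * n / 10 : ℕ) : ℝ))
          ≤ (2 : ℝ) ^ ((1 / 20 : ℝ) * n) * (2 : ℝ) ^ (L * b + ((9 * n / 10 : ℕ) : ℝ)) := by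
            gcongr; exact hn1 n (by omega)
        _ = (2 : ℝ) ^ ((1 / 20 : ℝ) * n + (L * b + ((9 * n / 10 : ℕ) : ℝ))) := by
            rw [← Real.rpow_add (by norm_num)]
        _ ≤ _ := by
            apply Real.rpow_le_rpow_of_exponent_le (by norm_num)
            linarith
    · refine hsimple.trans ?_
      apply Real.rpow_le_rpow_of_exponent_le (by norm_num)
      have hs : X2 B P ⊆ Finset.Icc 1 n := (Finset.filter_subset _ B).trans (h.hB.trans h.hA)
      rw [Finset.card_sdiff_of_subset hs] at hq
      simp only [Nat.card_Icc, Nat.add_sub_cancel] at hq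
      have h5 : 100 * (X2 B P).card ≤ 99 * n := by omega
      have h6 : (100 * (X2 B P).card : ℝ) ≤ 99 * n := by exact_mod_cast h5
      rw [h3]
      simp only [Finset.card_empty, Nat.cast_zero, add_zero]
      linarith
  · refine hsimple.trans ?_
    apply Real.rpow_le_rpow_of_exponent_le (by norm_num)
    have h4 := X3_bound h
    have h5 := X23_bound h h3
    have h4' : ((X3 B P).card : ℝ) ≤ ((n - A.card : ℕ) : ℝ) + 4 + 2 * b := by exact_mod_cast h4
    have h5' : ((X2 B P).card : ℝ) + (X3 B P).card ≤ (n + 1) / 2 + 1 + ((n - A.card : ℕ) : ℝ) + b := by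
      have e : (((n + 1) / 2 : ℕ) : ℝ) ≤ ((n + 1 : ℕ) : ℝ) / ((2 : ℕ) : ℝ) := Nat.cast_div_le
      push_cast at e
      have : ((X2 B P).card : ℝ) + (X3 B P).card ≤ (((n + 1) / 2 : ℕ) : ℝ) + 1 + ((n - A.card : ℕ) : ℝ) + b := by
        exact_mod_cast h5
      linarith
    generalize ((n - A.card : ℕ) : ℝ) = k at *
    generalize ((X3 B P).card : ℝ) = x3 at *
    generalize ((X2 B P).card : ℝ) = x2 at *
    have e1 : (L - 1) * x3 ≤ (L - 1) * (k + 4 + 2 * b) := by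
      apply mul_le_mul_of_nonneg_left h4' (by linarith)
    have e2 : L * k ≤ L * (ξ * n) := by gcongr
    have e3 : L * ξ * n ≤ 3 / 8 * n := by gcongr
    have e4 : (0 : ℝ) ≤ b := Nat.cast_nonneg b
    linarith

open Classical in
theorem clean_of_NT {r : ℕ} (n : ℕ) (hn : 1 ≤ n) (β : ℝ) (hβ : 0 < β) (A : Finset ℕ) (hA : A ⊆ Finset.Icc 1 n)
    (P : ℕ → Finset (Fin r)) (hne : ∀ x ∈ A, (P x).Nonempty)
    (hN : (NT (fun x y z : A => APR x.1 y.1 z.1) (fun x : A => P x.1) (fun x : A => P x.1)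
      (fun x : A => P x.1) : ℝ) ≤ β ^ 2 * n ^ 2) :
    ∃ (B : Finset ℕ) (R : ℕ → Finset ℕ), Clean n ⌊β * n⌋₊ A B P R := by
  set b := ⌊β * n⌋₊ with hb
  have hn0 : (0 : ℝ) < n := by exact_mod_cast hn
  let R : ℕ → Finset ℕ := fun z => A.filter (fun y => ∃ x ∈ A, APR x y z ∧ ∃ i ∈ P x, ∃ j ∈ P y, ∃ k ∈ P z, Rb i j k)
  let B := A.filter (fun z => (R z).card ≤ b)
  refine ⟨B, R, hA, Finset.filter_subset _ _, ?_, ?_, hne, ?_⟩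
  · have h1 : (A \ B).card * (b + 1) ≤ NT (fun x y z : A => APR x.1 y.1 z.1) (fun x : A => P x.1)
        (fun x : A => P x.1) (fun x : A => P x.1) := by
      have e1 : (A \ B).card * (b + 1) ≤ ∑ z ∈ A \ B, (R z).card := by
        rw [← smul_eq_mul]
        apply Finset.card_nsmul_le_sum
        intro z hz
        obtain ⟨hz1, hz2⟩ := Finset.mem_sdiff.1 hz
        by_contra hcon
        exact hz2 (Finset.mem_filter.2 ⟨hz1, by omega⟩)
      rw [← Finset.card_sigma] at e1
      refine e1.trans ?_
      unfold NT
      refine le_trans (Finset.card_le_card (t := Finset.image (fun p : A × A × A => (⟨p.2.2.1, p.2.1.1⟩ : (_ : ℕ) × ℕ)) _) ?_)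
        Finset.card_image_le
      rintro ⟨z, y⟩ hzy
      rw [Finset.mem_sigma] at hzy
      obtain ⟨hz, hy⟩ := hzy
      obtain ⟨hyA, x, hx, hap, hrb⟩ := Finset.mem_filter.1 hy
      have hzA := (Finset.mem_sdiff.1 hz).1
      rw [Finset.mem_image]
      exact ⟨(⟨x, hx⟩, ⟨y, hyA⟩, ⟨z, hzA⟩), Finset.mem_filter.2 ⟨Finset.mem_univ _, hap, hrb⟩, rfl⟩
    have h2 : ((A \ B).card : ℝ) * (b + 1) ≤ β ^ 2 * n ^ 2 := by
      refine le_trans ?_ hN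
      exact_mod_cast h1
    have h3 : β * n < b + 1 := Nat.lt_floor_add_one _
    rw [hb]
    apply Nat.le_floor
    have h4 : ((A \ B).card : ℝ) * (β * n) ≤ (β * n) * (β * n) := by
      have : ((A \ B).card : ℝ) * (β * n) ≤ ((A \ B).card : ℝ) * (b + 1) := by gcongr
      nlinarith
    exact le_of_mul_le_mul_right h4 (by positivity)
  · intro z hz
    exact (Finset.mem_filter.1 hz).2
  · intro x hx y hy z hz hap hR i hi j hj k hk hrb
    exact hR (Finset.mem_filter.2 ⟨hy, x, hx, hap, i, hi, j, hj, k, hk, hrb⟩)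

theorem apr_codeg (A : Finset ℕ) : Codeg (fun x y z : A => APR x.1 y.1 z.1) := by
  have key : ∀ x y : A, ∃ s : Finset A, s.card ≤ 3 ∧ ∀ z : A, APR x.1 y.1 z.1 → z ∈ s := by
    intro x y
    refine ⟨Finset.univ.filter (fun z : A => z.1 ∈ ({(x.1 + y.1) / 2, 2 * y.1 - x.1, 2 * x.1 - y.1} : Finset ℕ)), ?_, ?_⟩
    · refine (Finset.card_le_card_of_injOn (fun z : A => z.1) (t := {(x.1 + y.1) / 2, 2 * y.1 - x.1, 2 * x.1 - y.1}) ?_ ?_).trans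
        Finset.card_le_three
      · intro z hz; exact (Finset.mem_filter.1 hz).2
      · intro z _ w _ hzw; exact Subtype.ext hzw
    · rintro z ⟨-, -, -, h⟩
      simp only [Finset.mem_filter, Finset.mem_univ, true_and, Finset.mem_insert, Finset.mem_singleton]
      omega
  refine ⟨key, ?_, ?_⟩
  · intro x z
    obtain ⟨s, h1, h2⟩ := key x z
    refine ⟨s, h1, fun y hy => h2 y ?_⟩
    obtain ⟨g1, g2, g3, g4⟩ := hy
    exact ⟨by omega, by omega, by omega, by omega⟩
  · intro y z
    obtain ⟨s, h1, h2⟩ := key y z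
    refine ⟨s, h1, fun x hx => h2 x ?_⟩
    obtain ⟨g1, g2, g3, g4⟩ := hx
    exact ⟨by omega, by omega, by omega, by omega⟩

open Classical in
theorem two_color_count (r : ℕ) (A : Finset ℕ) :
    (Finset.univ.filter (fun c : A → Fin r => ∃ Q : Finset (Fin r), Q.card = 2 ∧ ∀ x, c x ∈ Q)).card ≤
      r.choose 2 * 2 ^ A.card := by
  have hsub : (Finset.univ.filter (fun c : A → Fin r => ∃ Q : Finset (Fin r), Q.card = 2 ∧ ∀ x, c x ∈ Q)) ⊆
      (Finset.powersetCard 2 (Finset.univ : Finset (Fin r))).biUnion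
        (fun Q => Fintype.piFinset (fun _ : A => Q)) := by
    intro c hc
    obtain ⟨Q, hQ, hcQ⟩ := (Finset.mem_filter.1 hc).2
    rw [Finset.mem_biUnion]
    exact ⟨Q, Finset.mem_powersetCard.2 ⟨Finset.subset_univ _, hQ⟩, Fintype.mem_piFinset.2 hcQ⟩
  refine (Finset.card_le_card hsub).trans (Finset.card_biUnion_le.trans ?_)
  refine (Finset.sum_le_card_nsmul _ _ (2 ^ A.card) ?_).trans ?_
  · intro Q hQ
    rw [Fintype.card_piFinset]
    simp [(Finset.mem_powersetCard.1 hQ).2]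
  · simp

theorem stmt_1 (r : ℕ) (hr : 3 ≤ r) (ξ : ℝ) (hξ0 : 0 < ξ)
    (hξ : ξ ≤ 3 / (5 + 8 * Real.logb 2 r)) :
    ∃ n₀ : ℕ, ∀ n : ℕ, n₀ ≤ n → ∀ A : Finset ℕ, A ⊆ Finset.Icc 1 n →
      (1 - ξ) * n ≤ (A.card : ℝ) →
      (g r A : ℝ) ≤ (r.choose 2 : ℝ) * 2 ^ A.card +
        (2 : ℝ) ^ (-(n : ℝ) / (36 * Real.logb 2 n)) * 2 ^ n := by
  classical
  obtain ⟨β, hβ, n1, hn1⟩ := KP_num r hr ξ hξ0 hξ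
  obtain ⟨n2, hn2⟩ := container r (β ^ 2) (1 / 400) (by positivity) (by norm_num)
  refine ⟨n1 + n2 + 4096, ?_⟩
  intro n hn A hA hAc
  have hAn : Fintype.card A ≤ n := by
    have := Finset.card_le_card hA
    simpa using this
  obtain ⟨T, hTc, hTN, hTcov⟩ := hn2 n (by omega) A (fun x y z : A => APR x.1 y.1 z.1) (apr_codeg A) hAn
  let ex : (A → Finset (Fin r)) → ℕ → Finset (Fin r) := fun Q y => if h : y ∈ A then Q ⟨y, h⟩ else ∅
  have hex : ∀ Q, (fun x : A => ex Q x.1) = Q := by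
    intro Q; funext x; simp [ex]
  have hKP : ∀ Q ∈ T, ((KP A (ex Q)).card : ℝ) ≤ (2 : ℝ) ^ ((199 / 200 : ℝ) * n) := by
    intro Q hQ
    by_cases hne : ∀ x ∈ A, (ex Q x).Nonempty
    · obtain ⟨B, R, hcl⟩ := clean_of_NT n (by omega) β hβ A hA (ex Q) hne (by rw [hex]; exact hTN Q hQ)
      exact hn1 n (by omega) _ (Nat.floor_le (by positivity)) A B (ex Q) R hcl hAc
    · push Not at hne
      obtain ⟨x, hx, hx0⟩ := hne
      have : KP A (ex Q) = ∅ := by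
        rw [Finset.eq_empty_iff_forall_notMem]
        intro c hc
        have h1 := (Finset.mem_filter.1 hc).2.2.1 ⟨x, hx⟩
        simp only [hx0] at h1
        simp at h1
      rw [this]
      simp only [Finset.card_empty, Nat.cast_zero]
      positivity
  have hg : g r A ≤ r.choose 2 * 2 ^ A.card + ∑ Q ∈ T, (KP A (ex Q)).card := by
    have e1 : g r A = (Finset.univ.filter (fun c : A → Fin r => RainbowAPFree A c)).card := by
      unfold g
      rw [Nat.card_eq_fintype_card, Fintype.card_subtype]
    rw [e1]
    have hsub : Finset.univ.filter (fun c : A → Fin r => RainbowAPFree A c) ⊆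
        (Finset.univ.filter (fun c : A → Fin r => ∃ Q : Finset (Fin r), Q.card = 2 ∧ ∀ x, c x ∈ Q)) ∪
          T.biUnion (fun Q => KP A (ex Q)) := by
      intro c hc
      have hc := (Finset.mem_filter.1 hc).2
      by_cases h2 : ∃ Q : Finset (Fin r), Q.card = 2 ∧ ∀ x, c x ∈ Q
      · exact Finset.mem_union_left _ (Finset.mem_filter.2 ⟨Finset.mem_univ _, h2⟩)
      · apply Finset.mem_union_right
        obtain ⟨Q, hQ, hcQ⟩ := hTcov c (fun x y z h => rf_apr hc x y z h)
        rw [Finset.mem_biUnion]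
        refine ⟨Q, hQ, Finset.mem_filter.2 ⟨Finset.mem_univ _, hc, ?_, h2⟩⟩
        intro x
        have : ex Q x.1 = Q x := congrFun (hex Q) x
        rw [this]
        exact hcQ x
    refine (Finset.card_le_card hsub).trans ((Finset.card_union_le _ _).trans ?_)
    refine Nat.add_le_add ?_ Finset.card_biUnion_le
    refine le_trans (le_of_eq ?_) (two_color_count r A)
    congr!
  have hsum : ((∑ Q ∈ T, (KP A (ex Q)).card : ℕ) : ℝ) ≤ (2 : ℝ) ^ ((399 / 400 : ℝ) * n) := by
    push_cast
    refine (Finset.sum_le_card_nsmul _ _ _ hKP).trans ?_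
    rw [nsmul_eq_mul]
    calc (T.card : ℝ) * (2 : ℝ) ^ ((199 / 200 : ℝ) * n)
        ≤ (2 : ℝ) ^ ((1 / 400 : ℝ) * n) * (2 : ℝ) ^ ((199 / 200 : ℝ) * n) := by gcongr
      _ = _ := by
        rw [← Real.rpow_add (by norm_num)]
        congr 1; ring
  have hlog : (12 : ℝ) ≤ Real.logb 2 n := by
    have h4 : (4096 : ℝ) ≤ n := by
      have : 4096 ≤ n := by omega
      exact_mod_cast this
    rw [Real.le_logb_iff_rpow_le (by norm_num) (by linarith)]
    refine le_trans (le_of_eq ?_) h4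
    norm_num
  have hfin : (2 : ℝ) ^ ((399 / 400 : ℝ) * n) ≤
      (2 : ℝ) ^ (-(n : ℝ) / (36 * Real.logb 2 n)) * 2 ^ n := by
    rw [← Real.rpow_natCast 2 n, ← Real.rpow_add (by norm_num)]
    apply Real.rpow_le_rpow_of_exponent_le (by norm_num)
    have h1 : (n : ℝ) / (36 * Real.logb 2 n) ≤ n / 400 := by
      apply div_le_div_of_nonneg_left (by positivity) (by norm_num)
      linarith
    rw [neg_div]
    linarith
  have hg' : (g r A : ℝ) ≤ (r.choose 2 : ℝ) * 2 ^ A.card + ((∑ Q ∈ T, (KP A (ex Q)).card : ℕ) : ℝ) := by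
    exact_mod_cast hg
  linarith
end

section
/- For every integer r ≥ 3 and every real ε > 0, there exists n₀ ∈ ℕ such that for all n ≥ n₀: (C(r,2) − ε)·2^n ≤ g_r([n]) ≤ (C(r,2) + ε)·2^n, and moreover the number of rainbow 3-AP-free r-colorings of [n] that use at least three distinct colors is at most ε·2^n (so almost all rainbow 3-AP-free r-colorings of [n] are 2-colorings). Here C(r,2) = r(r−1)/2. -/
namespace RainbowAux

open Classical Finset

/-- rainbow-free on `[1, m]` for a function on the naturals -/
def RF {r : ℕ} (m : ℕ) (c : ℕ → Fin r) : Prop :=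
  ∀ a d : ℕ, 0 < d → 1 ≤ a → a + 2 * d ≤ m →
    c a = c (a + d) ∨ c (a + d) = c (a + 2 * d) ∨ c a = c (a + 2 * d)

/-- all pairs pointing to `m + 1` are monochromatic -/
def Exc {r : ℕ} (m : ℕ) (c : ℕ → Fin r) : Prop :=
  ∀ a d : ℕ, 0 < d → 1 ≤ a → a + 2 * d = m + 1 → c a = c (a + d)

/-- at least three colors appear on `[1, m]` -/
def Three {r : ℕ} (m : ℕ) (c : ℕ → Fin r) : Prop :=
  ∃ i j k : ℕ, (1 ≤ i ∧ i ≤ m) ∧ (1 ≤ j ∧ j ≤ m) ∧ (1 ≤ k ∧ k ≤ m) ∧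
    c i ≠ c j ∧ c i ≠ c k ∧ c j ≠ c k

/-- extension by one value at `m + 1` -/
def ext {r : ℕ} (c : ℕ → Fin r) (m : ℕ) (x : Fin r) : ℕ → Fin r :=
  fun j => if j = m + 1 then x else c j

lemma ext_self {r : ℕ} (c : ℕ → Fin r) (m : ℕ) (x : Fin r) : ext c m x (m + 1) = x := by
  simp [ext]

lemma ext_ne {r : ℕ} (c : ℕ → Fin r) (m : ℕ) (x : Fin r) {j : ℕ} (h : j ≠ m + 1) :
    ext c m x j = c j := by
  simp [ext, h]

lemma rf_of_ext {r : ℕ} {c : ℕ → Fin r} {m : ℕ} {x : Fin r} (h : RF (m + 1) (ext c m x)) :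
    RF m c := by
  intro a d hd ha hm
  have := h a d hd ha (by omega)
  rwa [ext_ne _ _ _ (by omega), ext_ne _ _ _ (by omega), ext_ne _ _ _ (by omega)] at this

lemma ext_pair {r : ℕ} {c : ℕ → Fin r} {m : ℕ} {x : Fin r} (h : RF (m + 1) (ext c m x))
    {a d : ℕ} (hd : 0 < d) (ha : 1 ≤ a) (hm : a + 2 * d = m + 1) :
    c a = c (a + d) ∨ c (a + d) = x ∨ c a = x := by
  have := h a d hd ha (by omega)
  rwa [ext_ne _ _ _ (by omega), ext_ne _ _ _ (by omega), hm, ext_self] at this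

/-- valid extensions -/
noncomputable def V {r : ℕ} (m : ℕ) (c : ℕ → Fin r) : Finset (Fin r) :=
  univ.filter fun x => RF (m + 1) (ext c m x)

lemma mem_V {r : ℕ} {m : ℕ} {c : ℕ → Fin r} {x : Fin r} :
    x ∈ V m c ↔ RF (m + 1) (ext c m x) := by simp [V]

lemma V_sub {r : ℕ} {m : ℕ} {c : ℕ → Fin r} {a d : ℕ} (hd : 0 < d) (ha : 1 ≤ a)
    (hm : a + 2 * d = m + 1) (hne : c a ≠ c (a + d)) : V m c ⊆ {c a, c (a + d)} := by
  intro x hx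
  have := ext_pair (mem_V.1 hx) hd ha hm
  simp only [mem_insert, mem_singleton]
  rcases this with h | h | h
  · exact absurd h hne
  · exact Or.inr h.symm
  · exact Or.inl h.symm

lemma card_V_le {r : ℕ} {m : ℕ} {c : ℕ → Fin r} (h : ¬ Exc m c) : (V m c).card ≤ 2 := by
  unfold Exc at h
  push Not at h
  obtain ⟨a, d, hd, ha, hm, hne⟩ := h
  exact (card_le_card (V_sub hd ha hm hne)).trans card_le_two

lemma exc_of_birth {r : ℕ} {m : ℕ} {c : ℕ → Fin r} {x : Fin r} (h : RF (m + 1) (ext c m x))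
    (h3 : Three (m + 1) (ext c m x)) (hn : ¬ Three m c) : Exc m c := by
  have key : ∀ j, 1 ≤ j → j ≤ m → c j ≠ x := by
    intro l hl hlm hx
    apply hn
    obtain ⟨i, j, k, hi, hj, hk, h1, h2, h4⟩ := h3
    have lift : ∀ i, 1 ≤ i ∧ i ≤ m + 1 → ∃ i', (1 ≤ i' ∧ i' ≤ m) ∧ c i' = ext c m x i := by
      intro i hi
      by_cases hi' : i = m + 1
      · exact ⟨l, ⟨hl, hlm⟩, by rw [hi', ext_self, hx]⟩
      · exact ⟨i, by omega, by rw [ext_ne _ _ _ hi']⟩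
    obtain ⟨i', hi', ei⟩ := lift i hi
    obtain ⟨j', hj', ej⟩ := lift j hj
    obtain ⟨k', hk', ek⟩ := lift k hk
    exact ⟨i', j', k', hi', hj', hk', by rw [ei, ej]; exact h1, by rw [ei, ek]; exact h2,
      by rw [ej, ek]; exact h4⟩
  intro a d hd ha hm
  rcases ext_pair h hd ha hm with h | h | h
  · exact h
  · exact absurd h (key _ (by omega) (by omega))
  · exact absurd h (key _ (by omega) (by omega))

/-- the special pattern; `m = k + 2` -/
def IsC {r : ℕ} (k : ℕ) (c : ℕ → Fin r) : Prop :=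
  c (k + 2) ≠ c (k + 1) ∧ c (k + 2) = c k ∧ RF (k + 2) (ext c (k + 1) (c (k + 1)))

lemma isC_V {r : ℕ} {k : ℕ} {c : ℕ → Fin r} (hrf : RF (k + 2) c) (h3 : Three (k + 2) c)
    (hC : IsC k c) (hk : 1 ≤ k) : (V (k + 2) c).card ≤ 1 := by
  by_contra hcon
  obtain ⟨hne, heq, hsib⟩ := hC
  have hsub := V_sub (m := k + 2) (c := c) (a := k + 1) (d := 1) (by omega) (by omega) (by omega)
    (Ne.symm hne)
  have hVeq : V (k + 2) c = {c (k + 1), c (k + 1 + 1)} := by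
    apply eq_of_subset_of_card_le hsub
    exact card_le_two.trans (by omega)
  have hva : RF (k + 2 + 1) (ext c (k + 2) (c (k + 1))) := mem_V.1 (by rw [hVeq]; simp)
  have hve : RF (k + 2 + 1) (ext c (k + 2) (c (k + 2))) := mem_V.1 (by rw [hVeq]; simp)
  have key : ∀ t j, 1 ≤ j → j + t = k + 2 → c j = c (k + 1) ∨ c j = c (k + 2) := by
    intro t
    induction t using Nat.strong_induction_on with
    | _ t ih =>
      intro j hj hjt
      by_cases h0 : j = k + 2
      · right; rw [h0]
      by_cases h1 : j = k + 1
      · left; rw [h1]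
      by_contra hcc
      push Not at hcc
      rcases Nat.even_or_odd' t with ⟨d, hd | hd⟩
      · have hm := ih (t - d) (by omega) (j + d) (by omega) (by omega)
        have p1 := ext_pair (m := k + 1) hsib (a := j) (d := d) (by omega) hj (by omega)
        have p2 := hrf j d (by omega) hj (by omega)
        rw [show j + 2 * d = k + 2 by omega] at p2
        grind
      · have hm := ih (t - (d + 1)) (by omega) (j + (d + 1)) (by omega) (by omega)
        have p1 := ext_pair hva (a := j) (d := d + 1) (by omega) hj (by omega)
        have p2 := ext_pair hve (a := j) (d := d + 1) (by omega) hj (by omega)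
        grind
  obtain ⟨i, j, l, hi, hj, hl, h1, h2, h4⟩ := h3
  have a1 := key (k + 2 - i) i hi.1 (by omega)
  have a2 := key (k + 2 - j) j hj.1 (by omega)
  have a3 := key (k + 2 - l) l hl.1 (by omega)
  grind

/-- weights -/
noncomputable def w {r : ℕ} (m : ℕ) (c : ℕ → Fin r) : ℝ :=
  if IsC (m - 2) c then 5 / 8 else if c m ≠ c (m - 1) then 7 / 8 else 1

lemma w_le_one {r : ℕ} (m : ℕ) (c : ℕ → Fin r) : w m c ≤ 1 := by
  unfold w; split_ifs <;> norm_num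

lemma le_w {r : ℕ} (m : ℕ) (c : ℕ → Fin r) : 5 / 8 ≤ w m c := by
  unfold w; split_ifs <;> norm_num

lemma three_le {r : ℕ} {m : ℕ} {c : ℕ → Fin r} (h : Three m c) : 3 ≤ m := by
  obtain ⟨i, j, k, hi, hj, hk, h1, h2, h4⟩ := h
  have : i ≠ j := by rintro rfl; exact h1 rfl
  have : i ≠ k := by rintro rfl; exact h2 rfl
  have : j ≠ k := by rintro rfl; exact h4 rfl
  omega

lemma w_step {r : ℕ} {m : ℕ} {c : ℕ → Fin r} (hrf : RF m c) (h3 : Three m c)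
    (hx : ¬ Exc m c) : ∑ x ∈ V m c, w (m + 1) (ext c m x) ≤ 15 / 8 * w m c := by
  have hm := three_le h3
  obtain ⟨k, rfl⟩ : ∃ k, m = k + 2 := ⟨m - 2, by omega⟩
  by_cases hcard : (V (k + 2) c).card ≤ 1
  · have : ∑ x ∈ V (k + 2) c, w (k + 2 + 1) (ext c (k + 2) x) ≤ ∑ x ∈ V (k + 2) c, (1 : ℝ) :=
      sum_le_sum fun x _ => w_le_one _ _
    have h1 : ((V (k + 2) c).card : ℝ) ≤ 1 := by exact_mod_cast hcard
    simp only [sum_const, nsmul_eq_mul, mul_one] at this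
    linarith [le_w (k + 2) c]
  have h2 : (V (k + 2) c).card = 2 := by have := card_V_le hx; omega
  have hC : ¬ IsC k c := fun h => hcard (isC_V hrf h3 h (by omega))
  by_cases hB : c (k + 2) = c (k + 1)
  · have hw : w (k + 2) c = 1 := by
      unfold w
      rw [if_neg (by simpa using hC), if_neg (by simpa using hB)]
    obtain ⟨x, y, hxy, hV⟩ := card_eq_two.1 h2
    rw [hV, sum_pair hxy, hw]
    have small : ∀ z, z ≠ c (k + 2) → w (k + 2 + 1) (ext c (k + 2) z) ≤ 7 / 8 := by
      intro z hz
      unfold w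
      split_ifs with h1 h2
      · norm_num
      · norm_num
      · exfalso
        apply h2
        rw [ext_self, ext_ne _ _ _ (by omega)]
        simpa using hz
    by_cases hxc : x = c (k + 2)
    · linarith [small y (fun h => hxy (hxc.trans h.symm)), w_le_one (k + 2 + 1) (ext c (k + 2) x)]
    · linarith [small x hxc, w_le_one (k + 2 + 1) (ext c (k + 2) y)]
  · have hw : w (k + 2) c = 7 / 8 := by
      unfold w
      rw [if_neg (by simpa using hC), if_pos (by simpa using hB)]
    have hsub := V_sub (m := k + 2) (c := c) (a := k + 1) (d := 1) (by omega) (by omega) (by omega)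
      (Ne.symm hB)
    have hVeq : V (k + 2) c = {c (k + 1), c (k + 2)} := by
      apply eq_of_subset_of_card_le hsub
      exact card_le_two.trans (by omega)
    rw [hVeq, sum_pair (Ne.symm hB), hw]
    have hve : RF (k + 2 + 1) (ext c (k + 2) (c (k + 2))) := mem_V.1 (by rw [hVeq]; simp)
    have : w (k + 2 + 1) (ext c (k + 2) (c (k + 1))) = 5 / 8 := by
      unfold w
      rw [if_pos]
      refine ⟨?_, ?_, ?_⟩
      · rw [show k + 2 + 1 - 2 + 2 = k + 2 + 1 by omega, ext_self, ext_ne _ _ _ (by omega)]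
        exact Ne.symm hB
      · rw [show k + 2 + 1 - 2 + 2 = k + 2 + 1 by omega, ext_self, ext_ne _ _ _ (by omega)]
        rfl
      · have e : ext (ext c (k + 2) (c (k + 1))) (k + 2 + 1 - 2 + 1)
            (ext c (k + 2) (c (k + 1)) (k + 2 + 1 - 2 + 1)) = ext c (k + 2) (c (k + 2)) := by
          funext j
          simp only [ext]
          grind
        rw [e]
        exact hve
    linarith [w_le_one (k + 2 + 1) (ext c (k + 2) (c (k + 2)))]

/-- all functions supported on `[1, m]` -/
noncomputable def All (r : ℕ) [NeZero r] : ℕ → Finset (ℕ → Fin r)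
  | 0 => {fun _ => 0}
  | m + 1 => (All r m ×ˢ univ).image fun p => ext p.1 m p.2

lemma mem_All {r : ℕ} [NeZero r] {m : ℕ} {c : ℕ → Fin r} :
    c ∈ All r m ↔ ∀ j, (j = 0 ∨ m < j) → c j = 0 := by
  induction m generalizing c with
  | zero =>
    simp only [All, mem_singleton]
    constructor
    · rintro rfl j _; rfl
    · intro h; funext j; exact h j (by omega)
  | succ m ih =>
    simp only [All, mem_image, mem_product, mem_univ, and_true, Prod.exists]
    constructor
    · rintro ⟨c', x, hc', rfl⟩ j hj
      rw [ext_ne _ _ _ (by omega)]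
      exact ih.1 hc' j (by omega)
    · intro h
      refine ⟨fun j => if j = m + 1 then 0 else c j, c (m + 1), ih.2 ?_, ?_⟩
      · intro j hj
        by_cases hj' : j = m + 1
        · simp [hj']
        · simp only [hj', if_false]
          exact h j (by omega)
      · funext j
        simp only [ext]
        grind

lemma sum_All {r : ℕ} [NeZero r] (m : ℕ) (f : (ℕ → Fin r) → ℝ) :
    ∑ c ∈ All r (m + 1), f c = ∑ c ∈ All r m, ∑ x, f (ext c m x) := by
  rw [All, sum_image, sum_product]
  rintro ⟨c, x⟩ h ⟨c', x'⟩ h' he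
  simp only [coe_product, coe_univ, Set.mem_prod, mem_coe, Set.mem_univ, and_true] at h h'
  have hx : x = x' := by
    have := congrFun he (m + 1)
    simpa [ext_self] using this
  have hc : c = c' := by
    funext j
    by_cases hj : j = m + 1
    · rw [mem_All.1 h j (by omega), mem_All.1 h' j (by omega)]
    · have := congrFun he j
      simpa [ext_ne _ _ _ hj] using this
  rw [hx, hc]

noncomputable def F (r : ℕ) [NeZero r] (m : ℕ) : ℝ := ∑ c ∈ All r m, if RF m c then 1 else 0

noncomputable def E (r : ℕ) [NeZero r] (m : ℕ) : ℝ :=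
  ∑ c ∈ All r m, if RF m c ∧ Exc m c then 1 else 0

noncomputable def W (r : ℕ) [NeZero r] (m : ℕ) : ℝ :=
  ∑ c ∈ All r m, if RF m c ∧ Three m c then w m c else 0

lemma F_step (r : ℕ) [NeZero r] (m : ℕ) : F r (m + 1) ≤ 2 * F r m + r * E r m := by
  unfold F E
  rw [sum_All, mul_sum, mul_sum, ← sum_add_distrib]
  apply sum_le_sum
  intro c _
  have hV : (∑ x : Fin r, if RF (m + 1) (ext c m x) then (1 : ℝ) else 0) = (V m c).card := by
    rw [sum_boole]; rfl
  rw [hV]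
  by_cases hrf : RF m c
  · by_cases hx : Exc m c
    · simp only [hrf, hx, and_self, if_true]
      have : ((V m c).card : ℝ) ≤ r := by
        exact_mod_cast (card_le_univ _).trans (by simp)
      linarith
    · simp only [hrf, hx, and_false, if_true, if_false]
      have : ((V m c).card : ℝ) ≤ 2 := by exact_mod_cast card_V_le hx
      linarith
  · have : V m c = ∅ := by
      ext x
      simp only [mem_V, notMem_empty, iff_false]
      exact fun h => hrf (rf_of_ext h)
    simp [this, hrf]

lemma W_step (r : ℕ) [NeZero r] (m : ℕ) : W r (m + 1) ≤ 15 / 8 * W r m + r * E r m := by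
  unfold W E
  rw [sum_All, mul_sum, mul_sum, ← sum_add_distrib]
  apply sum_le_sum
  intro c _
  have hV : (∑ x : Fin r, if RF (m + 1) (ext c m x) ∧ Three (m + 1) (ext c m x)
      then w (m + 1) (ext c m x) else 0) ≤ ∑ x ∈ V m c, w (m + 1) (ext c m x) := by
    unfold V
    rw [sum_filter]
    apply sum_le_sum
    intro x _
    have := le_w (m + 1) (ext c m x)
    split_ifs <;> first | linarith | tauto
  by_cases hrf : RF m c
  · by_cases hx : Exc m c
    · have h1 : ∑ x ∈ V m c, w (m + 1) (ext c m x) ≤ ∑ x ∈ V m c, (1 : ℝ) :=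
        sum_le_sum fun x _ => w_le_one _ _
      have : ((V m c).card : ℝ) ≤ r := by
        exact_mod_cast (card_le_univ _).trans (by simp)
      simp only [sum_const, nsmul_eq_mul, mul_one] at h1
      have h0 : 0 ≤ if RF m c ∧ Three m c then w m c else 0 := by
        have := le_w m c
        split_ifs <;> linarith
      rw [if_pos (show RF m c ∧ Exc m c from ⟨hrf, hx⟩)]
      linarith
    · by_cases h3 : Three m c
      · simp only [hrf, hx, h3, and_false, and_self, if_true, if_false]
        linarith [w_step hrf h3 hx]
      · simp only [hrf, hx, h3, and_false, if_false]
        rw [sum_eq_zero]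
        · simp
        · intro x _
          rw [if_neg]
          rintro ⟨h, h'⟩
          exact hx (exc_of_birth h h' h3)
  · simp only [hrf, false_and, if_false]
    rw [sum_eq_zero]
    · simp
    · intro x _
      rw [if_neg]
      rintro ⟨h, _⟩
      exact hrf (rf_of_ext h)

lemma E_le (r : ℕ) [NeZero r] (m : ℕ) : E r m ≤ F r ((m + 1) / 2) := by
  unfold E F
  rw [sum_boole, sum_boole]
  norm_cast
  apply card_le_card_of_injOn (fun c j => if j ≤ (m + 1) / 2 then c j else 0)
  · intro c hc
    simp only [coe_filter, Set.mem_ofPred_eq] at hc ⊢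
    obtain ⟨hA, hrf, -⟩ := hc
    refine ⟨mem_All.2 ?_, ?_⟩
    · rintro j (rfl | hj)
      · simpa using mem_All.1 hA 0 (by simp)
      · rw [if_neg (by omega)]
    · intro a d hd ha hm
      beta_reduce
      rw [if_pos (by omega), if_pos (by omega), if_pos (by omega)]
      exact hrf a d hd ha (by omega)
  · intro c hc c' hc' he
    simp only [coe_filter, Set.mem_ofPred_eq] at hc hc'
    obtain ⟨hA, -, hx⟩ := hc
    obtain ⟨hA', -, hx'⟩ := hc'
    funext j
    induction j using Nat.strong_induction_on with
    | _ j ih =>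
      by_cases h1 : j ≤ (m + 1) / 2
      · have := congrFun he j
        simpa [h1] using this
      · by_cases h2 : j ≤ m
        · have e1 := hx (2 * j - (m + 1)) (m + 1 - j) (by omega) (by omega) (by omega)
          have e2 := hx' (2 * j - (m + 1)) (m + 1 - j) (by omega) (by omega) (by omega)
          rw [show 2 * j - (m + 1) + (m + 1 - j) = j by omega] at e1 e2
          rw [← e1, ← e2]
          exact ih _ (by omega)
        · rw [mem_All.1 hA j (by omega), mem_All.1 hA' j (by omega)]

lemma F_nonneg (r : ℕ) [NeZero r] (m : ℕ) : 0 ≤ F r m := by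
  unfold F
  apply sum_nonneg
  intro c _
  split_ifs <;> norm_num

lemma three_pow_half (m : ℕ) : (3 : ℝ) ^ ((m + 1) / 2) ≤ 7 / 4 * (7 / 4) ^ m := by
  calc (3 : ℝ) ^ ((m + 1) / 2) ≤ ((7 / 4) ^ 2) ^ ((m + 1) / 2) := by
        gcongr; norm_num
    _ = (7 / 4) ^ (2 * ((m + 1) / 2)) := by rw [pow_mul]
    _ ≤ (7 / 4) ^ (m + 1) := by
        apply pow_le_pow_right₀ (by norm_num); omega
    _ = _ := by rw [pow_succ]; ring

lemma F_bound (r : ℕ) [NeZero r] : ∃ K : ℝ, 0 ≤ K ∧ ∀ m, F r m ≤ K * 3 ^ m := by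
  -- eventually r * 3^((m+1)/2) ≤ 3^m
  have ht : Filter.Tendsto (fun m : ℕ => (r : ℝ) * (7 / 4) * (7 / 12 : ℝ) ^ m)
      Filter.atTop (nhds ((r : ℝ) * (7 / 4) * 0)) :=
    (tendsto_pow_atTop_nhds_zero_of_lt_one (by norm_num) (by norm_num)).const_mul _
  rw [mul_zero] at ht
  obtain ⟨m0, hm0⟩ := Filter.eventually_atTop.1 (ht.eventually (ge_mem_nhds (show (0 : ℝ) < 1 by norm_num)))
  have hm1 : ∀ m, m0 ≤ m → (r : ℝ) * 3 ^ ((m + 1) / 2) ≤ 3 ^ m := by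
    intro m hm
    have h1 := hm0 m hm
    have h2 := three_pow_half m
    have h3 : (7 / 4 : ℝ) ^ m = (7 / 12) ^ m * 3 ^ m := by rw [← mul_pow]; norm_num
    calc (r : ℝ) * 3 ^ ((m + 1) / 2) ≤ r * (7 / 4 * (7 / 4) ^ m) := by gcongr
      _ = (r * (7 / 4) * (7 / 12) ^ m) * 3 ^ m := by rw [h3]; ring
      _ ≤ 1 * 3 ^ m := by gcongr
      _ = 3 ^ m := one_mul _
  refine ⟨∑ i ∈ range (m0 + 2), F r i, sum_nonneg fun i _ => F_nonneg r i, ?_⟩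
  set K := ∑ i ∈ range (m0 + 2), F r i with hK
  have hK0 : 0 ≤ K := sum_nonneg fun i _ => F_nonneg r i
  intro m
  induction m using Nat.strong_induction_on with
  | _ m ih =>
    by_cases hm : m < m0 + 2
    · have h1 : F r m ≤ K := single_le_sum (f := fun i => F r i) (fun i _ => F_nonneg r i) (mem_range.2 hm)
      have h2 : (1 : ℝ) ≤ 3 ^ m := one_le_pow₀ (by norm_num)
      nlinarith
    · obtain ⟨k, rfl⟩ : ∃ k, m = k + 1 := ⟨m - 1, by omega⟩
      have a1 := ih k (by omega)
      have a2 := ih ((k + 1) / 2) (by omega)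
      have a3 := hm1 k (by omega)
      have a4 : (r : ℝ) * E r k ≤ K * 3 ^ k := by
        calc (r : ℝ) * E r k ≤ r * (K * 3 ^ ((k + 1) / 2)) := by
              gcongr; exact (E_le r k).trans a2
          _ = K * (r * 3 ^ ((k + 1) / 2)) := by ring
          _ ≤ K * 3 ^ k := by gcongr
      have a5 := F_step r k
      rw [pow_succ]
      linarith

lemma W_bound (r : ℕ) [NeZero r] : ∃ K : ℝ, 0 ≤ K ∧ ∀ m, W r m ≤ K * (31 / 16) ^ m := by
  obtain ⟨K, hK, hF⟩ := F_bound r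
  have hE : ∀ m, (r : ℝ) * E r m ≤ r * K * (7 / 4) * (31 / 16) ^ m := by
    intro m
    calc (r : ℝ) * E r m ≤ r * (K * (7 / 4 * (31 / 16) ^ m)) := by
          gcongr
          refine (E_le r m).trans ((hF _).trans ?_)
          gcongr
          refine (three_pow_half m).trans ?_
          have : (7 / 4 : ℝ) ^ m ≤ (31 / 16) ^ m := pow_le_pow_left₀ (by norm_num) (by norm_num) m
          linarith
      _ = _ := by ring
  refine ⟨16 * (r * K * (7 / 4)), by positivity, ?_⟩
  have hr : (0 : ℝ) ≤ r * K * (7 / 4) := by positivity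
  intro m
  induction m with
  | zero =>
    have : W r 0 = 0 := by
      unfold W
      apply sum_eq_zero
      intro c _
      rw [if_neg]
      rintro ⟨-, h⟩
      have := three_le h
      omega
    rw [this]
    positivity
  | succ m ih =>
    have h1 := W_step r m
    have h2 := hE m
    rw [pow_succ]
    linarith

/-- extension of a coloring of `[n]` to the naturals -/
noncomputable def toFun {r : ℕ} [NeZero r] {n : ℕ} (c : Finset.Icc 1 n → Fin r) : ℕ → Fin r :=
  fun j => if h : j ∈ Finset.Icc 1 n then c ⟨j, h⟩ else 0

lemma toFun_mem {r : ℕ} [NeZero r] {n : ℕ} (c : Finset.Icc 1 n → Fin r) {j : ℕ}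
    (h : j ∈ Finset.Icc 1 n) : toFun c j = c ⟨j, h⟩ := by
  simp only [toFun, dif_pos h]

lemma count_three (r : ℕ) [NeZero r] (n : ℕ) :
    (Nat.card {c : Finset.Icc 1 n → Fin r //
          RainbowAPFree (Finset.Icc 1 n) c ∧
            3 ≤ (Finset.univ.image c).card} : ℝ) ≤ 8 / 5 * W r n := by
  have h1 : Nat.card {c : Finset.Icc 1 n → Fin r //
          RainbowAPFree (Finset.Icc 1 n) c ∧
            3 ≤ (Finset.univ.image c).card} ≤
      ((All r n).filter fun c => RF n c ∧ Three n c).card := by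
    have hmem : ∀ c : Finset.Icc 1 n → Fin r, RainbowAPFree (Finset.Icc 1 n) c ∧
        3 ≤ (Finset.univ.image c).card →
        toFun c ∈ (All r n).filter fun c => RF n c ∧ Three n c := by
      rintro c ⟨hrf, h3⟩
      refine mem_filter.2 ⟨mem_All.2 ?_, ?_, ?_⟩
      · intro j hj
        have : j ∉ Finset.Icc 1 n := by rw [Finset.mem_Icc]; omega
        simp only [toFun, dif_neg this]
      · intro a d hd ha hm
        have m1 : a ∈ Finset.Icc 1 n := by rw [Finset.mem_Icc]; omega
        have m2 : a + d ∈ Finset.Icc 1 n := by rw [Finset.mem_Icc]; omega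
        have m3 : a + 2 * d ∈ Finset.Icc 1 n := by rw [Finset.mem_Icc]; omega
        rw [toFun_mem c m1, toFun_mem c m2, toFun_mem c m3]
        exact hrf a d hd m1 m2 m3
      · obtain ⟨x, hx, y, hy, z, hz, h1, h2, h4⟩ := Finset.two_lt_card.1 h3
        obtain ⟨⟨i, hi⟩, -, rfl⟩ := mem_image.1 hx
        obtain ⟨⟨j, hj⟩, -, rfl⟩ := mem_image.1 hy
        obtain ⟨⟨k, hk⟩, -, rfl⟩ := mem_image.1 hz
        refine ⟨i, j, k, Finset.mem_Icc.1 hi, Finset.mem_Icc.1 hj, Finset.mem_Icc.1 hk, ?_⟩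
        rw [toFun_mem c hi, toFun_mem c hj, toFun_mem c hk]
        exact ⟨h1, h2, h4⟩
    have hinj := Nat.card_le_card_of_injective
      (fun c : {c : Finset.Icc 1 n → Fin r // RainbowAPFree (Finset.Icc 1 n) c ∧
          3 ≤ (Finset.univ.image c).card} =>
        (⟨toFun c.1, hmem c.1 c.2⟩ : ((All r n).filter fun c => RF n c ∧ Three n c))) (by
        rintro ⟨c, hc⟩ ⟨c', hc'⟩ he
        simp only [Subtype.mk.injEq] at he ⊢
        funext ⟨j, hj⟩
        rw [← toFun_mem c hj, ← toFun_mem c' hj, he])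
    refine hinj.trans (le_of_eq ?_)
    rw [Nat.card_eq_fintype_card, Fintype.card_coe]
  have h2 : (((All r n).filter fun c => RF n c ∧ Three n c).card : ℝ) ≤ 8 / 5 * W r n := by
    unfold W
    rw [← sum_filter, mul_sum, card_eq_sum_ones]
    push_cast
    apply sum_le_sum
    intro c _
    linarith [le_w n c]
  exact le_trans (by exact_mod_cast h1) h2

/-- colorings with values in `T` -/
noncomputable def AT {r : ℕ} (n : ℕ) (T : Finset (Fin r)) : Finset (Finset.Icc 1 n → Fin r) :=
  Fintype.piFinset fun _ => T

lemma mem_AT {r n : ℕ} {T : Finset (Fin r)} {c : Finset.Icc 1 n → Fin r} :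
    c ∈ AT n T ↔ ∀ i, c i ∈ T := by simp [AT]

lemma card_AT {r n : ℕ} {T : Finset (Fin r)} (h : T.card = 2) : (AT n T).card = 2 ^ n := by
  simp [AT, h]

lemma g_eq (r n : ℕ) : g r (Finset.Icc 1 n) =
    (univ.filter fun c : Finset.Icc 1 n → Fin r => RainbowAPFree (Finset.Icc 1 n) c).card := by
  rw [g, Nat.card_eq_fintype_card, Fintype.card_subtype]

lemma g_upper (r n : ℕ) (hr : 3 ≤ r) : g r (Finset.Icc 1 n) ≤ r.choose 2 * 2 ^ n +
    Nat.card {c : Finset.Icc 1 n → Fin r //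
          RainbowAPFree (Finset.Icc 1 n) c ∧ 3 ≤ (Finset.univ.image c).card} := by
  rw [g_eq, Nat.card_eq_fintype_card, Fintype.card_subtype]
  have hsub : (univ.filter fun c : Finset.Icc 1 n → Fin r => RainbowAPFree (Finset.Icc 1 n) c) ⊆
      (powersetCard 2 (univ : Finset (Fin r))).biUnion (AT n) ∪
      univ.filter fun c : Finset.Icc 1 n → Fin r =>
        RainbowAPFree (Finset.Icc 1 n) c ∧ 3 ≤ (Finset.univ.image c).card := by
    intro c hc
    have hc := (mem_filter.1 hc).2
    by_cases h3 : 3 ≤ (Finset.univ.image c).card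
    · exact mem_union_right _ (mem_filter.2 ⟨mem_univ _, hc, h3⟩)
    · apply mem_union_left
      obtain ⟨T, hT, hT2⟩ := exists_superset_card_eq (s := Finset.univ.image c) (n := 2)
        (by omega) (by rw [Fintype.card_fin]; omega)
      refine mem_biUnion.2 ⟨T, mem_powersetCard.2 ⟨subset_univ _, hT2⟩, mem_AT.2 ?_⟩
      intro i
      exact hT (mem_image_of_mem _ (mem_univ _))
  refine (card_le_card hsub).trans ((card_union_le _ _).trans ?_)
  refine Nat.add_le_add ?_ le_rfl
  refine (card_biUnion_le_card_mul _ _ (2 ^ n) ?_).trans ?_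
  · intro T hT
    rw [card_AT (mem_powersetCard.1 hT).2]
  · simp

lemma g_lower (r n : ℕ) (hn : 1 ≤ n) :
    r.choose 2 * (2 ^ n - r) ≤ g r (Finset.Icc 1 n) := by
  rw [g_eq]
  set C : Finset (Finset.Icc 1 n → Fin r) := univ.image fun x _ => x with hC
  have hCc : C.card ≤ r := card_image_le.trans (by simp)
  have hsub : (powersetCard 2 (univ : Finset (Fin r))).biUnion (fun T => AT n T \ C) ⊆
      univ.filter fun c : Finset.Icc 1 n → Fin r => RainbowAPFree (Finset.Icc 1 n) c := by
    intro c hc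
    obtain ⟨T, hT, hcT⟩ := mem_biUnion.1 hc
    have hcT := mem_AT.1 (mem_sdiff.1 hcT).1
    refine mem_filter.2 ⟨mem_univ _, ?_⟩
    obtain ⟨x, y, hxy, rfl⟩ := card_eq_two.1 (mem_powersetCard.1 hT).2
    intro a d hd h1 h2 h3
    have e1 := hcT ⟨a, h1⟩
    have e2 := hcT ⟨a + d, h2⟩
    have e3 := hcT ⟨a + 2 * d, h3⟩
    simp only [mem_insert, mem_singleton] at e1 e2 e3
    grind
  refine le_trans ?_ (card_le_card hsub)
  rw [card_biUnion]
  · have : ∑ T ∈ powersetCard 2 (univ : Finset (Fin r)), (2 ^ n - r) ≤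
        ∑ T ∈ powersetCard 2 (univ : Finset (Fin r)), (AT n T \ C).card := by
      apply sum_le_sum
      intro T hT
      have h1 := le_card_sdiff C (AT n T)
      rw [card_AT (mem_powersetCard.1 hT).2] at h1
      omega
    simpa using this
  · intro T hT T' hT' hne
    change Disjoint (AT n T \ C) (AT n T' \ C)
    rw [disjoint_left]
    intro c hc hc'
    obtain ⟨h1, hnC⟩ := mem_sdiff.1 hc
    have h2 := (mem_sdiff.1 hc').1
    apply hnC
    rw [mem_coe] at hT hT'
    have hle : (T ∩ T').card ≤ 1 := by
      by_contra hcon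
      have c1 := (mem_powersetCard.1 hT).2
      have c2 := (mem_powersetCard.1 hT').2
      have e1 := eq_of_subset_of_card_le (inter_subset_left (s₁ := T) (s₂ := T')) (by omega)
      have e2 := eq_of_subset_of_card_le (inter_subset_right (s₁ := T) (s₂ := T')) (by omega)
      exact hne (e1.symm.trans e2)
    rw [hC]
    refine mem_image.2 ⟨c ⟨1, by simp [hn]⟩, mem_univ _, ?_⟩
    funext i
    exact card_le_one.1 hle _ (mem_inter.2 ⟨mem_AT.1 h1 _, mem_AT.1 h2 _⟩) _
      (mem_inter.2 ⟨mem_AT.1 h1 _, mem_AT.1 h2 _⟩)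

end RainbowAux

theorem stmt_2 (r : ℕ) (hr : 3 ≤ r) (ε : ℝ) (hε : 0 < ε) :
    ∃ n₀ : ℕ, ∀ n : ℕ, n₀ ≤ n →
      (((r.choose 2 : ℝ) - ε) * 2 ^ n ≤ (g r (Finset.Icc 1 n) : ℝ) ∧
        (g r (Finset.Icc 1 n) : ℝ) ≤ ((r.choose 2 : ℝ) + ε) * 2 ^ n) ∧
      (Nat.card {c : Finset.Icc 1 n → Fin r //
          RainbowAPFree (Finset.Icc 1 n) c ∧
            3 ≤ (Finset.univ.image c).card} : ℝ) ≤ ε * 2 ^ n := by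
  haveI : NeZero r := ⟨by omega⟩
  obtain ⟨K, hK, hW⟩ := RainbowAux.W_bound r
  have t1 : Filter.Tendsto (fun n : ℕ => 8 / 5 * K * (31 / 32 : ℝ) ^ n)
      Filter.atTop (nhds (8 / 5 * K * 0)) :=
    (tendsto_pow_atTop_nhds_zero_of_lt_one (by norm_num) (by norm_num)).const_mul _
  have t2 : Filter.Tendsto (fun n : ℕ => (r.choose 2 : ℝ) * r * (1 / 2 : ℝ) ^ n)
      Filter.atTop (nhds ((r.choose 2 : ℝ) * r * 0)) :=
    (tendsto_pow_atTop_nhds_zero_of_lt_one (by norm_num) (by norm_num)).const_mul _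
  rw [mul_zero] at t1 t2
  obtain ⟨n1, h1⟩ := Filter.eventually_atTop.1 (t1.eventually (ge_mem_nhds hε))
  obtain ⟨n2, h2⟩ := Filter.eventually_atTop.1 (t2.eventually (ge_mem_nhds hε))
  refine ⟨max (max n1 n2) 1, fun n hn => ?_⟩
  have a1 := h1 n (by omega)
  have a2 := h2 n (by omega)
  have p2 : (0 : ℝ) < 2 ^ n := by positivity
  have b3 : (Nat.card {c : Finset.Icc 1 n → Fin r //
          RainbowAPFree (Finset.Icc 1 n) c ∧
            3 ≤ (Finset.univ.image c).card} : ℝ) ≤ ε * 2 ^ n := by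
    have c1 := RainbowAux.count_three r n
    have c2 := hW n
    have c3 : (31 / 16 : ℝ) ^ n = (31 / 32) ^ n * 2 ^ n := by rw [← mul_pow]; norm_num
    calc _ ≤ 8 / 5 * (K * (31 / 16) ^ n) := by linarith
      _ = (8 / 5 * K * (31 / 32) ^ n) * 2 ^ n := by rw [c3]; ring
      _ ≤ ε * 2 ^ n := by gcongr
  refine ⟨⟨?_, ?_⟩, b3⟩
  · have l := RainbowAux.g_lower r n (by omega)
    have l1 : (r.choose 2 : ℝ) * (2 ^ n - r) ≤ (g r (Finset.Icc 1 n) : ℝ) := by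
      have l2 : ((r.choose 2 * (2 ^ n - r) : ℕ) : ℝ) ≤ (g r (Finset.Icc 1 n) : ℝ) := by
        exact_mod_cast l
      refine le_trans ?_ l2
      rw [Nat.cast_mul]
      gcongr
      have l3 : 2 ^ n ≤ (2 ^ n - r) + r := by omega
      have l4 : (2 : ℝ) ^ n ≤ ((2 ^ n - r : ℕ) : ℝ) + r := by exact_mod_cast l3
      linarith
    have e : (r.choose 2 : ℝ) * r ≤ ε * 2 ^ n := by
      have e1 : (1 / 2 : ℝ) ^ n * 2 ^ n = 1 := by rw [← mul_pow]; norm_num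
      calc (r.choose 2 : ℝ) * r = ((r.choose 2 : ℝ) * r * (1 / 2) ^ n) * 2 ^ n := by
            rw [mul_assoc _ ((1 / 2 : ℝ) ^ n), e1, mul_one]
        _ ≤ ε * 2 ^ n := by gcongr
    linarith
  · have u := RainbowAux.g_upper r n hr
    have u1 : (g r (Finset.Icc 1 n) : ℝ) ≤ r.choose 2 * 2 ^ n +
        Nat.card {c : Finset.Icc 1 n → Fin r //
          RainbowAPFree (Finset.Icc 1 n) c ∧ 3 ≤ (Finset.univ.image c).card} := by
      exact_mod_cast u
    linarith
end
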